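/- arXiv:2409.00901 — 5 statements merged into one kernel-verified Lean document; each statement's English description precedes it below -/
import Mathlib

section
/- Let n ∈ ℕ with n ≥ 1 and let g ∈ PWL(n+1). Then g ∈ NN_{1,1}(n+1, 1). Moreover, if there exists a ∈ ℝ such that g is constant on (−∞, a], then g ∈ NN_{1,1}(n, 1). -/
open MeasureTheory ENNReal Finset

noncomputable section

/-- The ReLU activation function. -/
def relu (t : ℝ) : ℝ := max t 0

/-- `A` is an affine map `ℝ^n → ℝ^m`. -/
def IsAffineMap {n m : ℕ} (A : (Fin n → ℝ) → (Fin m → ℝ)) : Prop :=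
  ∃ (M : Matrix (Fin m) (Fin n) ℝ) (c : Fin m → ℝ),
    ∀ x i, A x i = (∑ j, M i j * x j) + c i

/-- Auxiliary definition of the ReLU network class, by recursion on the number
of hidden layers. -/
def NNaux (k W : ℕ) : ℕ → (d : ℕ) → Set ((Fin d → ℝ) → (Fin k → ℝ))
  | 0, _ => {g | IsAffineMap g}
  | (L + 1), d => {g | ∃ N : ℕ, 1 ≤ N ∧ N ≤ W ∧
      ∃ (A : (Fin d → ℝ) → (Fin N → ℝ)) (h : (Fin N → ℝ) → (Fin k → ℝ)),
        IsAffineMap A ∧ h ∈ NNaux k W L N ∧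
        g = fun x => h (fun i => relu (A x i))}

/-- The class `NN_{d,k}(W,L)` of functions `ℝ^d → ℝ^k` computed by fully connected
ReLU networks with width at most `W` and `L` hidden layers. -/
def NN (d k W L : ℕ) : Set ((Fin d → ℝ) → (Fin k → ℝ)) := NNaux k W L d

end

/-- `g` is a continuous piecewise linear function with at most `n` pieces:
there are extended-real points `⊥ = t 0 ≤ t 1 ≤ ⋯ ≤ t n = ⊤` such that `g`
is affine on each open interval `(t (i-1), t i)`. -/
def IsPWL (n : ℕ) (g : ℝ → ℝ) : Prop :=
  Continuous g ∧ ∃ t : Fin (n + 1) → EReal, Monotone t ∧ t 0 = ⊥ ∧ t (Fin.last n) = ⊤ ∧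
    ∀ i : Fin n, ∃ a b : ℝ, ∀ x : ℝ,
      t i.castSucc < (x : EReal) → (x : EReal) < t i.succ → g x = a * x + b

lemma relu_of_nonneg {t : ℝ} (h : 0 ≤ t) : relu t = t := max_eq_left h

lemma relu_of_nonpos {t : ℝ} (h : t ≤ 0) : relu t = 0 := max_eq_right h

lemma continuous_relu : Continuous relu := continuous_id.max continuous_const

/-- Subtracting a suitable multiple of a shifted ReLU removes the breakpoint `v` between two
adjacent affine pieces, and changes nothing to the left of the first piece. -/
lemma exists_relu_merge {g : ℝ → ℝ} (hg : Continuous g) {u v : EReal} (huv : u ≤ v)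
    (h₁ : ∃ a b : ℝ, ∀ x : ℝ, u < (x : EReal) → (x : EReal) < v → g x = a * x + b)
    (h₂ : ∃ a b : ℝ, ∀ x : ℝ, v < (x : EReal) → g x = a * x + b) :
    ∃ c s : ℝ, (∀ x : ℝ, (x : EReal) < u → c * relu (x - s) = 0) ∧
      ∃ a b : ℝ, ∀ x : ℝ, u < (x : EReal) → g x - c * relu (x - s) = a * x + b := by
  obtain ⟨a₁, b₁, h₁⟩ := h₁
  obtain ⟨a₂, b₂, h₂⟩ := h₂
  rcases huv.eq_or_lt with rfl | huv
  · exact ⟨0, 0, by simp, a₂, b₂, by simpa using h₂⟩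
  induction v with
  | bot => simp at huv
  | top => exact ⟨0, 0, by simp, a₁, b₁, fun x hx => by simpa using h₁ x hx (EReal.coe_lt_top x)⟩
  | coe s =>
    obtain ⟨r, hur, hrs⟩ := EReal.lt_iff_exists_real_btwn.1 huv
    rw [EReal.coe_lt_coe_iff] at hrs
    have hs₂ : g s = a₂ * s + b₂ := by
      have h : Set.EqOn g (fun x => a₂ * x + b₂) (Set.Ioi s) := fun x hx =>
        h₂ x (EReal.coe_lt_coe_iff.2 hx)
      exact h.closure hg (by fun_prop) (by simp)
    have hs₁ : g s = a₁ * s + b₁ := by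
      have h : Set.EqOn g (fun x => a₁ * x + b₁) (Set.Ioo r s) := fun x hx =>
        h₁ x (hur.trans (EReal.coe_lt_coe_iff.2 hx.1)) (EReal.coe_lt_coe_iff.2 hx.2)
      exact h.closure hg (by fun_prop) (by simp [closure_Ioo hrs.ne, hrs.le])
    refine ⟨a₂ - a₁, s, fun x hx => ?_, a₁, b₁, fun x hx => ?_⟩
    · have hxs : x < s := EReal.coe_lt_coe_iff.1 (hx.trans huv)
      rw [relu_of_nonpos (by linarith), mul_zero]
    · rcases lt_trichotomy x s with hxs | rfl | hxs
      · rw [relu_of_nonpos (by linarith), h₁ x hx (EReal.coe_lt_coe_iff.2 hxs)]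
        ring
      · rw [relu_of_nonpos (by linarith), hs₁]
        ring
      · rw [relu_of_nonneg (by linarith), h₂ x (EReal.coe_lt_coe_iff.2 hxs)]
        linarith

lemma IsPWL.exists_sub_relu {n : ℕ} {g : ℝ → ℝ} (hg : IsPWL (n + 2) g) :
    ∃ c s : ℝ, IsPWL (n + 1) (fun x => g x - c * relu (x - s)) := by
  obtain ⟨hc, t, ht, h0, hlast, hp⟩ := hg
  obtain ⟨c, s, hz, hm⟩ := exists_relu_merge hc
    (ht (Fin.castSucc_le_succ (Fin.last n).castSucc))
    (hp (Fin.last n).castSucc)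
    (by
      obtain ⟨a, b, h⟩ := hp (Fin.last (n + 1))
      refine ⟨a, b, fun x hx => h x hx ?_⟩
      rw [Fin.succ_last, hlast]
      exact EReal.coe_lt_top x)
  have hcont : Continuous fun x => g x - c * relu (x - s) :=
    hc.sub (continuous_const.mul (continuous_relu.comp (continuous_id.sub continuous_const)))
  refine ⟨c, s, hcont, fun i => if i = Fin.last (n + 1) then ⊤ else t i.castSucc, ?_, ?_, ?_, ?_⟩
  · intro i j hij
    by_cases hj : j = Fin.last (n + 1)
    · simp [hj]
    · have hi : i ≠ Fin.last (n + 1) := fun hi => hj (Fin.last_le_iff.1 (hi ▸ hij))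
      simpa [hi, hj] using ht (Fin.castSucc_le_castSucc_iff.2 hij)
  · simpa [Fin.ext_iff] using h0
  · simp
  · intro i
    by_cases hi : i = Fin.last n
    · subst hi
      obtain ⟨a, b, h⟩ := hm
      exact ⟨a, b, fun x hx _ => h x (by simpa [Fin.castSucc_ne_last] using hx)⟩
    · obtain ⟨a, b, h⟩ := hp i.castSucc
      have hi' : i.succ ≠ Fin.last (n + 1) := by
        rwa [← Fin.succ_last, Ne, Fin.succ_inj]
      refine ⟨a, b, fun x hx hx' => ?_⟩
      simp only [Fin.castSucc_ne_last, hi', if_false] at hx hx'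
      have hle : t i.succ.castSucc ≤ t (Fin.last n).castSucc.castSucc := by
        refine ht ?_
        have := Fin.lt_last_iff_ne_last.2 hi
        simp only [Fin.le_def, Fin.lt_def, Fin.val_castSucc, Fin.val_succ, Fin.val_last] at this ⊢
        omega
      simpa only [hz x (hx'.trans_le hle), sub_zero] using h x hx hx'

/-- A continuous piecewise linear function with at most `n + 1` pieces is the sum of an affine
function and `n` shifted ReLUs. -/
lemma IsPWL.exists_eq_sum_relu {n : ℕ} {g : ℝ → ℝ} (hg : IsPWL (n + 1) g) :
    ∃ (a b : ℝ) (c s : Fin n → ℝ), ∀ x, g x = a * x + b + ∑ i, c i * relu (x - s i) := by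
  induction n generalizing g with
  | zero =>
    obtain ⟨-, t, -, h0, hlast, hp⟩ := hg
    obtain ⟨a, b, h⟩ := hp 0
    refine ⟨a, b, 0, 0, fun x => ?_⟩
    have h1 : t (Fin.succ 0) = ⊤ := hlast
    have h2 : t (Fin.castSucc 0) = ⊥ := h0
    simpa using h x (h2 ▸ EReal.bot_lt_coe x) (h1 ▸ EReal.coe_lt_top x)
  | succ n ih =>
    obtain ⟨c₀, s₀, h⟩ := hg.exists_sub_relu
    obtain ⟨a, b, c, s, h⟩ := ih h
    refine ⟨a, b, Fin.cons c₀ c, Fin.cons s₀ s, fun x => ?_⟩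
    simp only [Fin.sum_univ_succ, Fin.cons_zero, Fin.cons_succ]
    linarith [h x]

/-- A function of one variable that is a constant plus a linear combination of `N` ReLUs of affine
functions is computed by a network with one hidden layer of width `N`. -/
lemma mem_NN_one_layer {N : ℕ} (hN : 1 ≤ N) {g : ℝ → ℝ} (b : ℝ) (c w v : Fin N → ℝ)
    (h : ∀ x, g x = b + ∑ i, c i * relu (w i * x + v i)) :
    (fun x (_ : Fin 1) => g (x 0)) ∈ NN 1 1 N 1 := by
  refine ⟨N, hN, le_rfl, fun x i => w i * x 0 + v i, fun y _ => ∑ i, c i * y i + b,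
    ⟨fun i _ => w i, v, fun x i => by simp⟩, ⟨fun _ i => c i, fun _ => b, fun x i => rfl⟩, ?_⟩
  funext x _
  rw [h, add_comm]

/-- The slope of the affine part vanishes if the function is constant near `-∞`. -/
lemma slope_eq_zero_of_const {n : ℕ} {g : ℝ → ℝ} {a b : ℝ} {c s : Fin n → ℝ}
    (h : ∀ x, g x = a * x + b + ∑ i, c i * relu (x - s i)) {r : ℝ} (hr : ∀ x ≤ r, g x = g r) :
    a = 0 := by
  obtain ⟨m, hm⟩ := (Set.finite_range s).bddBelow
  have key : ∀ x ≤ min r m, g r = a * x + b := fun x hx => by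
    rw [← hr x (hx.trans (min_le_left _ _)), h x, Finset.sum_eq_zero, add_zero]
    intro i _
    have : m ≤ s i := hm ⟨i, rfl⟩
    rw [relu_of_nonpos (by linarith [min_le_right r m]), mul_zero]
  linarith [key (min r m) le_rfl, key (min r m - 1) (by linarith)]

theorem pwl_realization (n : ℕ) (hn : 1 ≤ n) (g : ℝ → ℝ) (hg : IsPWL (n + 1) g) :
    (fun x (_ : Fin 1) => g (x 0)) ∈ NN 1 1 (n + 1) 1 ∧
    ((∃ a : ℝ, ∀ x ≤ a, g x = g a) → (fun x (_ : Fin 1) => g (x 0)) ∈ NN 1 1 n 1) := by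
  obtain ⟨a, b, c, s, h⟩ := hg.exists_eq_sum_relu
  refine ⟨?_, fun ⟨r, hr⟩ => ?_⟩
  · obtain ⟨m, rfl⟩ := Nat.exists_eq_succ_of_ne_zero (Nat.one_le_iff_ne_zero.1 hn)
    refine mem_NN_one_layer (by omega) (b + a * s 0)
      (Fin.cons (-a) (Fin.cons (c 0 + a) fun i => c i.succ))
      (Fin.cons (-1) fun _ => 1) (Fin.cons (s 0) fun i => -s i) fun x => ?_
    rw [h x]
    simp only [Fin.sum_univ_succ, Fin.cons_zero, Fin.cons_succ, one_mul, ← sub_eq_add_neg]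
    have hx : relu (x - s 0) - relu (-1 * x + s 0) = x - s 0 := by
      rcases le_total x (s 0) with hx | hx
      · rw [relu_of_nonpos (by linarith), relu_of_nonneg (by linarith)]
        ring
      · rw [relu_of_nonneg (by linarith), relu_of_nonpos (by linarith)]
        ring
    linear_combination -a * hx
  · have ha := slope_eq_zero_of_const h hr
    refine mem_NN_one_layer hn b c (fun _ => 1) (fun i => -s i) fun x => ?_
    simp [h x, ha, sub_eq_add_neg]
end

section
/- Let W, L, n ∈ ℕ with W, L ≥ 1, let α ≤ β be real numbers, and let g ∈ PWL(n+1) be such that every breakpoint of g (every point where g is not differentiable) lies in the interval [α, β]. If n ≤ 6W²L, then there exists f ∈ NN_{1,1}(6W+2, 2L) such that f(t) = g(t) for all t ∈ [α, β]. -/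
open MeasureTheory ENNReal Finset

lemma relu_mul {a : ℝ} (ha : 0 ≤ a) (t : ℝ) : relu (a * t) = a * relu t := by
  simp [relu, mul_max_of_nonneg _ _ ha]

/-! ### Piecewise linear functions with prescribed breakpoints -/

/-- The space of continuous piecewise linear functions spanned by the affine functions and the
functions `t ↦ relu (t - s)` with `s ∈ P`. -/
def PL (P : Set ℝ) : Submodule ℝ (ℝ → ℝ) :=
  Submodule.span ℝ ({(fun _ => 1), id} ∪ (fun s t => relu (t - s)) '' P)

lemma one_mem_PL (P : Set ℝ) : (fun _ => 1 : ℝ → ℝ) ∈ PL P :=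
  Submodule.subset_span (by simp)

lemma id_mem_PL (P : Set ℝ) : (id : ℝ → ℝ) ∈ PL P :=
  Submodule.subset_span (by simp)

lemma relu_mem_PL {P : Set ℝ} {s : ℝ} (hs : s ∈ P) : (fun t => relu (t - s)) ∈ PL P :=
  Submodule.subset_span (Or.inr ⟨s, hs, rfl⟩)

lemma affine_mem_PL (P : Set ℝ) (a b : ℝ) : (fun t => a * t + b) ∈ PL P := by
  convert add_mem ((PL P).smul_mem a (id_mem_PL P)) ((PL P).smul_mem b (one_mem_PL P)) using 1
  ext t
  simp

lemma PL_mono {P Q : Set ℝ} (h : P ⊆ Q) : PL P ≤ PL Q :=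
  Submodule.span_mono (Set.union_subset_union_right _ (Set.image_mono h))

lemma PL_union (P Q : Set ℝ) : PL (P ∪ Q) ≤ PL P ⊔ PL Q := by
  rw [PL, PL, PL, ← Submodule.span_union, Set.image_union]
  exact Submodule.span_mono (by intro x; simp only [Set.mem_union]; tauto)

lemma PL_continuous {P : Set ℝ} {f : ℝ → ℝ} (hf : f ∈ PL P) : Continuous f := by
  induction hf using Submodule.span_induction with
  | mem x h =>
    rcases h with (rfl | rfl) | ⟨s, -, rfl⟩
    · exact continuous_const
    · exact continuous_id
    · unfold relu
      fun_prop
  | zero => exact continuous_const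
  | add x y _ _ hx hy => exact hx.add hy
  | smul a x _ hx => exact hx.const_smul a

lemma PL_bounded {P : Set ℝ} {f : ℝ → ℝ} (hf : f ∈ PL P) (α β : ℝ) :
    ∃ C, ∀ t ∈ Set.Icc α β, |f t| ≤ C :=
  isCompact_Icc.exists_bound_of_continuousOn (PL_continuous hf).continuousOn

/-- To the right of all breakpoints, a piecewise linear function is affine. -/
lemma PL_affine_right {P : Set ℝ} {X : ℝ} (hP : ∀ s ∈ P, s ≤ X) {f : ℝ → ℝ} (hf : f ∈ PL P) :
    ∃ a b : ℝ, ∀ t, X ≤ t → f t = a * t + b := by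
  induction hf using Submodule.span_induction with
  | mem x h =>
    rcases h with (rfl | rfl) | ⟨s, hs, rfl⟩
    · exact ⟨0, 1, by simp⟩
    · exact ⟨1, 0, by simp⟩
    · refine ⟨1, -s, fun t ht => ?_⟩
      have := hP s hs
      simp only
      rw [relu_of_nonneg (by linarith)]
      ring
  | zero => exact ⟨0, 0, by simp⟩
  | add x y _ _ hx hy =>
    obtain ⟨a, b, h⟩ := hx
    obtain ⟨a', b', h'⟩ := hy
    refine ⟨a + a', b + b', fun t ht => ?_⟩
    rw [Pi.add_apply, h t ht, h' t ht]
    ring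
  | smul c x _ hx =>
    obtain ⟨a, b, h⟩ := hx
    refine ⟨c * a, c * b, fun t ht => ?_⟩
    rw [Pi.smul_apply, h t ht, smul_eq_mul]
    ring

lemma exists_coeff_of_mem_PL {ι : Type*} [Fintype ι] {y : ι → ℝ} {f : ℝ → ℝ}
    (hf : f ∈ PL (Set.range y)) :
    ∃ (a b : ℝ) (c : ι → ℝ), ∀ t, f t = a * t + b + ∑ i, c i * relu (t - y i) := by
  rw [PL, Submodule.span_union, Submodule.mem_sup] at hf
  obtain ⟨p, hp, q, hq, rfl⟩ := hf
  obtain ⟨b, a, rfl⟩ := Submodule.mem_span_pair.1 hp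
  rw [← Set.range_comp, Submodule.mem_span_range_iff_exists_fun] at hq
  obtain ⟨c, rfl⟩ := hq
  refine ⟨a, b, c, fun t => ?_⟩
  simp
  ring

/-- A continuous function that is affine between consecutive points of a monotone sequence
is piecewise linear with breakpoints in that sequence. -/
lemma exists_PL_eqOn {g : ℝ → ℝ} (hg : Continuous g) {x : ℕ → ℝ} (hx : Monotone x) (n : ℕ)
    (h : ∀ k < n + 1, ∃ a b : ℝ, ∀ t ∈ Set.Ioo (x k) (x (k + 1)), g t = a * t + b) :
    ∃ T ∈ PL (x '' Set.Icc 1 n), ∀ t ∈ Set.Icc (x 0) (x (n + 1)), g t = T t := by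
  have closed : ∀ k < n + 1, ∃ a b : ℝ, ∀ t ∈ Set.Icc (x k) (x (k + 1)), g t = a * t + b := by
    intro k hk
    rcases (hx k.le_succ).eq_or_lt with he | hlt
    · refine ⟨0, g (x k), fun t ht => ?_⟩
      rw [le_antisymm (ht.2.trans he.ge) ht.1]
      ring
    · obtain ⟨a, b, hab⟩ := h k hk
      refine ⟨a, b, fun t ht => ?_⟩
      rw [Nat.succ_eq_add_one] at hlt
      have hEq : Set.EqOn g (fun t => a * t + b) (closure (Set.Ioo (x k) (x (k + 1)))) :=
        Set.EqOn.closure hab hg (by fun_prop)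
      rw [closure_Ioo hlt.ne] at hEq
      exact hEq ht
  clear h
  induction n with
  | zero =>
    obtain ⟨a, b, hab⟩ := closed 0 (by simp)
    exact ⟨_, affine_mem_PL _ a b, hab⟩
  | succ n ih =>
    obtain ⟨T, hT, hgT⟩ := ih fun k hk => closed k (by omega)
    obtain ⟨a, b, hab⟩ := closed (n + 1) (by omega)
    obtain ⟨a', b', hab'⟩ := PL_affine_right (X := x (n + 1))
      (by rintro _ ⟨k, hk, rfl⟩; exact hx (by have := hk.2; omega)) hT
    refine ⟨T + (a - a') • fun t => relu (t - x (n + 1)), add_mem (PL_mono ?_ hT)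
      (Submodule.smul_mem _ _ (relu_mem_PL ⟨n + 1, by simp, rfl⟩)), fun t ht => ?_⟩
    · exact Set.image_mono (Set.Icc_subset_Icc_right (by omega))
    · simp only [Pi.add_apply, Pi.smul_apply, smul_eq_mul]
      rcases le_total t (x (n + 1)) with hle | hge
      · rw [relu_of_nonpos (by linarith), hgT t ⟨ht.1, hle⟩]
        ring
      · rw [relu_of_nonneg (by linarith), hab t ⟨hge, ht.2⟩, hab' t hge]
        have h1 := hgT (x (n + 1)) ⟨hx (by omega), le_rfl⟩
        rw [hab _ ⟨le_rfl, hx (by omega)⟩, hab' _ le_rfl] at h1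
        linarith

/-- On a compact interval, a function with at most `n + 1` pieces is piecewise linear with at
most `n` breakpoints. -/
lemma IsPWL.exists_PL_eqOn {n : ℕ} {g : ℝ → ℝ} (hg : IsPWL (n + 1) g) {α β : ℝ} (hαβ : α ≤ β) :
    ∃ S : Finset ℝ, S.card ≤ n ∧ ∃ T ∈ PL S, ∀ t ∈ Set.Icc α β, g t = T t := by
  obtain ⟨hc, τ, hτ, hbot, htop, hp⟩ := hg
  let z : ℕ → EReal := fun k => max α (min β (τ (Fin.ofNat (n + 2) (min k (n + 1)))))
  have hz_bot : ∀ k, z k ≠ ⊥ := fun k =>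
    ((EReal.bot_lt_coe α).trans_le (le_max_left _ _)).ne'
  have hz_top : ∀ k, z k ≠ ⊤ := fun k =>
    (max_lt (EReal.coe_lt_top α) ((min_le_left _ _).trans_lt (EReal.coe_lt_top β))).ne
  have hz : ∀ k, ((z k).toReal : EReal) = z k := fun k =>
    EReal.coe_toReal (hz_top k) (hz_bot k)
  have hmono : Monotone fun k => (z k).toReal := by
    intro i j hij
    refine EReal.toReal_le_toReal ?_ (hz_bot i) (hz_top j)
    refine max_le_max le_rfl (min_le_min le_rfl (hτ ?_))
    rw [Fin.le_def]
    simp only [Fin.ofNat]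
    rw [Nat.mod_eq_of_lt (by omega), Nat.mod_eq_of_lt (by omega)]
    omega
  have h0 : (z 0).toReal = α := by
    have : τ (Fin.ofNat (n + 2) (min 0 (n + 1))) = ⊥ := by simpa using hbot
    simp only [z, this]
    simp
  have h1 : (z (n + 1)).toReal = β := by
    have : τ (Fin.ofNat (n + 2) (min (n + 1) (n + 1))) = ⊤ := by
      rw [← htop]
      congr 1
      ext
      simp
    simp only [z, this]
    simp [hαβ]
  obtain ⟨T, hT, hgT⟩ := _root_.exists_PL_eqOn hc hmono n (by
    intro k hk
    obtain ⟨a, b, hab⟩ := hp ⟨k, hk⟩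
    refine ⟨a, b, fun t ht => ?_⟩
    have hβ : t < β := ht.2.trans_le (by rw [← h1]; exact hmono (by omega))
    have hα : α < t := lt_of_le_of_lt (by rw [← h0]; exact hmono (by omega)) ht.1
    have e1 := EReal.coe_lt_coe_iff.2 ht.1
    have e2 := EReal.coe_lt_coe_iff.2 ht.2
    rw [hz] at e1 e2
    apply hab
    · have e3 := lt_of_le_of_lt (le_max_right _ _) e1
      rcases min_lt_iff.1 e3 with e4 | e4
      · exact absurd (EReal.coe_lt_coe_iff.1 e4) hβ.not_gt
      · convert e4 using 2
        ext
        simp only [Fin.ofNat, Fin.val_castSucc]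
        rw [Nat.mod_eq_of_lt (by omega)]
        omega
    · rcases lt_max_iff.1 e2 with e4 | e4
      · exact absurd (EReal.coe_lt_coe_iff.1 e4) hα.not_gt
      · have e5 := (lt_min_iff.1 e4).2
        convert e5 using 2
        ext
        simp only [Fin.ofNat, Fin.val_succ]
        rw [Nat.mod_eq_of_lt (by omega)]
        omega)
  refine ⟨(Finset.Icc 1 n).image fun k => (z k).toReal, ?_, T, ?_, ?_⟩
  · exact Finset.card_image_le.trans (by simp)
  · simpa using hT
  · simpa only [h0, h1] using hgT

/-! ### Creating many kinks with a single neuron -/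

/-- A zigzag function with breakpoints `u k < v k` can be chosen to cross zero only at the points
`y k`, with prescribed slopes there, so that its positive part has prescribed convex kinks at
the points `y k`. -/
lemma exists_relu_comp_eq {P : Set ℝ} {y δ u v : ℕ → ℝ} (hδ : ∀ k, 0 ≤ δ k)
    (hyu : ∀ k, y k ≤ u k) (huv : ∀ k, u k < v k) (hvy : ∀ k, v k ≤ y (k + 1)) (K : ℕ)
    (hu : ∀ k < K, u k ∈ P) (hv : ∀ k, k + 1 < K → v k ∈ P) :
    ∃ g ∈ PL P, ∃ r ∈ PL P,
      ∀ t, relu (g t) = r t + ∑ k ∈ Finset.range K, δ k * relu (t - y k) := by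
  rcases K with _ | K
  · exact ⟨0, zero_mem _, 0, zero_mem _, fun t => by simp [relu]⟩
  suffices ∃ g ∈ PL P, ∃ r ∈ PL P,
      (∀ t, relu (g t) = r t + ∑ k ∈ Finset.range (K + 1), δ k * relu (t - y k)) ∧
      ((∀ t, u K ≤ t → g t = δ K * (t - y K)) ∨ ∀ t, u K ≤ t → g t = -(δ K * (t - y K))) by
    obtain ⟨g, hg, r, hr, h, -⟩ := this
    exact ⟨g, hg, r, hr, h⟩
  induction K with
  | zero =>
    refine ⟨_, affine_mem_PL P (δ 0) (-(δ 0 * y 0)), 0, zero_mem _, fun t => ?_,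
      Or.inl fun t _ => by ring⟩
    simp [← relu_mul (hδ 0), mul_add, sub_eq_add_neg]
  | succ K ih =>
    obtain ⟨g, hg, r, hr, h, hs⟩ := ih (fun k hk => hu k (by omega)) fun k hk => hv k (by omega)
    have hpos : 0 < v K - u K := sub_pos.2 (huv K)
    have hmem : ∀ f ∈ PL P, ∀ A B : ℝ,
        (fun t => f t + A * relu (t - u K) + B * relu (t - v K)) ∈ PL P := fun f hf A B =>
      add_mem (add_mem hf ((PL P).smul_mem A (relu_mem_PL (hu K (by omega)))))
        ((PL P).smul_mem B (relu_mem_PL (hv K (by omega))))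
    have hyu' := hyu K
    have huv' := huv K
    have hvy' := hvy K
    have hyu'' := hyu (K + 1)
    have ha : 0 ≤ δ K * (u K - y K) := mul_nonneg (hδ K) (by linarith)
    have hw : 0 ≤ δ (K + 1) * (y (K + 1) - v K) := mul_nonneg (hδ _) (by linarith)
    -- the slope of the segment joining the old zigzag at `u K` to the new one at `v K`
    obtain ⟨s, hs'⟩ : ∃ s, s * (v K - u K) =
        δ (K + 1) * (y (K + 1) - v K) - δ K * (u K - y K) :=
      ⟨_, div_mul_cancel₀ _ hpos.ne'⟩
    have hseg : ∀ t, u K ≤ t → t ≤ v K → 0 ≤ δ K * (u K - y K) + s * (t - u K) := by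
      intro t h1 h2
      refine nonneg_of_mul_nonneg_left (b := v K - u K) ?_ hpos
      have e : (δ K * (u K - y K) + s * (t - u K)) * (v K - u K) =
          δ K * (u K - y K) * (v K - t) + δ (K + 1) * (y (K + 1) - v K) * (t - u K) := by
        linear_combination (t - u K) * hs'
      rw [e]
      exact add_nonneg (mul_nonneg ha (by linarith)) (mul_nonneg hw (by linarith))
    rcases hs with hs | hs
    · have hnew : ∀ t, v K ≤ t → g t + (s - δ K) * relu (t - u K)
          + (-δ (K + 1) - s) * relu (t - v K) = -(δ (K + 1) * (t - y (K + 1))) := by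
        intro t ht
        rw [hs t (by linarith), relu_of_nonneg (by linarith : 0 ≤ t - u K),
          relu_of_nonneg (by linarith : 0 ≤ t - v K)]
        linear_combination hs'
      refine ⟨_, hmem g hg (s - δ K) (-δ (K + 1) - s), _, hmem r hr (s - δ K) (-δ (K + 1) - s),
        fun t => ?_, Or.inr fun t ht => hnew t (by linarith)⟩
      rw [Finset.sum_range_succ]
      rcases le_total t (u K) with h1 | h1
      · rw [relu_of_nonpos (by linarith : t - u K ≤ 0),
          relu_of_nonpos (by linarith : t - v K ≤ 0),
          relu_of_nonpos (by linarith : t - y (K + 1) ≤ 0)]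
        simp only [mul_zero, add_zero]
        exact h t
      have h0 := h t
      rw [relu_of_nonneg (t := g t)
        (by rw [hs t h1]; exact mul_nonneg (hδ K) (by linarith))] at h0
      rcases le_total t (v K) with h2 | h2
      · have h3 := hseg t h1 h2
        have h4 := hs t h1
        rw [relu_of_nonneg (by linarith : 0 ≤ t - u K),
          relu_of_nonpos (by linarith : t - v K ≤ 0),
          relu_of_nonpos (by linarith : t - y (K + 1) ≤ 0), relu_of_nonneg (by linarith)]
        linear_combination h0
      · have h3 : relu (-(δ (K + 1) * (t - y (K + 1)))) =
            -(δ (K + 1) * (t - y (K + 1))) + δ (K + 1) * relu (t - y (K + 1)) := by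
          rcases le_total t (y (K + 1)) with h4 | h4
          · rw [relu_of_nonpos (by linarith : t - y (K + 1) ≤ 0), relu_of_nonneg]
            · ring
            · nlinarith [hδ (K + 1)]
          · rw [relu_of_nonneg (by linarith : 0 ≤ t - y (K + 1)), relu_of_nonpos]
            · ring
            · nlinarith [hδ (K + 1)]
        rw [hnew t h2, h3, ← hnew t h2]
        linear_combination h0
    · have hnew : ∀ t, v K ≤ t → g t + (δ K - s) * relu (t - u K)
          + (δ (K + 1) + s) * relu (t - v K) = δ (K + 1) * (t - y (K + 1)) := by
        intro t ht
        rw [hs t (by linarith), relu_of_nonneg (by linarith : 0 ≤ t - u K),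
          relu_of_nonneg (by linarith : 0 ≤ t - v K)]
        linear_combination -hs'
      refine ⟨_, hmem g hg (δ K - s) (δ (K + 1) + s), r, hr, fun t => ?_,
        Or.inl fun t ht => hnew t (by linarith)⟩
      rw [Finset.sum_range_succ]
      rcases le_total t (u K) with h1 | h1
      · rw [relu_of_nonpos (by linarith : t - u K ≤ 0),
          relu_of_nonpos (by linarith : t - v K ≤ 0),
          relu_of_nonpos (by linarith : t - y (K + 1) ≤ 0)]
        simp only [mul_zero, add_zero]
        exact h t
      have h0 := h t
      rw [relu_of_nonpos (t := g t)
        (by rw [hs t h1]; nlinarith [hδ K, mul_nonneg (hδ K) (by linarith : 0 ≤ t - y K)])] at h0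
      rcases le_total t (v K) with h2 | h2
      · have h3 := hseg t h1 h2
        have h4 := hs t h1
        rw [relu_of_nonneg (by linarith : 0 ≤ t - u K),
          relu_of_nonpos (by linarith : t - v K ≤ 0),
          relu_of_nonpos (by linarith : t - y (K + 1) ≤ 0), relu_of_nonpos (by linarith)]
        linear_combination h0
      · rw [hnew t h2, relu_mul (hδ _)]
        linear_combination h0

lemma exists_strictMono_subset_image (S : Finset ℝ) :
    ∃ x : ℕ → ℝ, StrictMono x ∧ (S : Set ℝ) ⊆ x '' Set.Iio S.card := by
  obtain ⟨M, hM⟩ := S.bddAbove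
  refine ⟨fun k => if h : k < S.card then S.orderEmbOfFin rfl ⟨k, h⟩ else M + (k + 1), ?_, ?_⟩
  · intro i j hij
    by_cases hj : j < S.card
    · simp only [hj, hij.trans hj, dif_pos]
      exact (S.orderEmbOfFin rfl).strictMono hij
    · have hij' : (i : ℝ) < j := by exact_mod_cast hij
      by_cases hi : i < S.card
      · simp only [hi, hj, dif_pos, dif_neg, not_false_iff]
        have := hM (S.orderEmbOfFin_mem rfl ⟨i, hi⟩)
        have : (0 : ℝ) ≤ j := Nat.cast_nonneg j
        linarith
      · simp only [hi, hj, dif_neg, not_false_iff]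
        linarith
  · intro s hs
    rw [← S.range_orderEmbOfFin rfl] at hs
    obtain ⟨k, rfl⟩ := hs
    exact ⟨k, k.2, by simp⟩

/-- A piecewise linear function with at most `6 * W ^ 2` breakpoints is computed by two hidden
layers: the neurons of the first one have breakpoints `ξ`, and the second one has at most `6 * W`
neurons besides the free channel carrying `p`. -/
lemma exists_two_layer {W : ℕ} {S : Finset ℝ} (hS : S.card ≤ 6 * W ^ 2) {T : ℝ → ℝ}
    (hT : T ∈ PL S) :
    ∃ (ξ : Fin (6 * W) → ℝ) (M : ℕ) (g : Fin M → ℝ → ℝ) (ε : Fin M → ℝ) (p : ℝ → ℝ),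
      M ≤ 6 * W ∧ (∀ k, g k ∈ PL (Set.range ξ)) ∧ p ∈ PL (Set.range ξ) ∧
      ∀ t, T t = p t + ∑ k, ε k * relu (g k t) := by
  obtain ⟨x, hx, hSx⟩ := exists_strictMono_subset_image S
  let idx : Fin 2 × Fin W → ℕ → ℕ := fun q k => (2 * k + q.1) * W + q.2
  let y : (Fin 2 × Fin W) × Fin (3 * W) → ℝ := fun q => x (idx q.1 q.2)
  have hSy : (S : Set ℝ) ⊆ Set.range y := by
    intro s hs
    obtain ⟨k, hk, rfl⟩ := hSx hs
    have hk : k < (6 * W) * W := by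
      have := hk.trans_le hS
      rwa [pow_two, ← mul_assoc] at this
    have hW : 0 < W := by
      rcases Nat.eq_zero_or_pos W with rfl | h
      · simp at hk
      · exact h
    have hd : k / W < 6 * W := Nat.div_lt_of_lt_mul (by rwa [mul_comm])
    refine ⟨((⟨k / W % 2, Nat.mod_lt _ two_pos⟩, ⟨k % W, Nat.mod_lt _ hW⟩),
      ⟨k / W / 2, by omega⟩), ?_⟩
    simp only [y, idx]
    rw [Nat.div_add_mod, Nat.div_add_mod']
  obtain ⟨a, b, c, hc⟩ := exists_coeff_of_mem_PL (PL_mono hSy hT)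
  let ξ : ℕ → ℝ := fun j => x (j * W + (W - 1))
  have key : ∀ (q : Fin 2 × Fin W) (δ : ℕ → ℝ), (∀ k, 0 ≤ δ k) →
      ∃ g ∈ PL (Set.range fun j : Fin (6 * W) => ξ j),
      ∃ r ∈ PL (Set.range fun j : Fin (6 * W) => ξ j), ∀ t, relu (g t) =
        r t + ∑ k ∈ Finset.range (3 * W), δ k * relu (t - x (idx q k)) := by
    rintro ⟨⟨i, hi⟩, ⟨l, hl⟩⟩ δ hδ
    refine exists_relu_comp_eq (u := fun k => ξ (2 * k + i)) (v := fun k => ξ (2 * k + i + 1))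
      hδ (fun k => hx.monotone ?_) (fun k => hx ?_) (fun k => hx.monotone ?_) _ ?_ ?_
    · simp only [idx]
      omega
    · simp only [add_mul]
      omega
    · simp only [idx, add_mul, mul_add]
      omega
    · intro k hk
      exact ⟨⟨2 * k + i, by omega⟩, rfl⟩
    · intro k hk
      exact ⟨⟨2 * k + i + 1, by omega⟩, rfl⟩
  let coef : Fin 2 × Fin W → ℕ → ℝ := fun q k => if h : k < 3 * W then c (q, ⟨k, h⟩) else 0
  choose g₁ hg₁ r₁ hr₁ h₁ using fun q => key q (fun k => relu (coef q k)) fun k => le_max_right _ _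
  choose g₂ hg₂ r₂ hr₂ h₂ using fun q =>
    key q (fun k => relu (-coef q k)) fun k => le_max_right _ _
  let ι := (Fin 2 × Fin W) ⊕ (Fin 2 × Fin W)
  let e : Fin (Fintype.card ι) ≃ ι := (Fintype.equivFin ι).symm
  refine ⟨fun j => ξ j, Fintype.card ι, fun k => Sum.elim g₁ g₂ (e k),
    fun k => Sum.elim (fun _ => 1) (fun _ => -1) (e k),
    (fun t => a * t + b) + ∑ q, (r₂ q - r₁ q), ?_, ?_, ?_, fun t => ?_⟩
  · simp only [ι, Fintype.card_sum, Fintype.card_prod, Fintype.card_fin]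
    omega
  · intro k
    beta_reduce
    rcases e k with q | q
    · exact hg₁ q
    · exact hg₂ q
  · exact add_mem (affine_mem_PL _ a b) (sum_mem fun q _ => sub_mem (hr₂ q) (hr₁ q))
  · rw [e.sum_comp fun z => Sum.elim (fun _ => (1 : ℝ)) (fun _ => -1) z *
      relu (Sum.elim g₁ g₂ z t), Fintype.sum_sum_type, hc, Fintype.sum_prod_type]
    simp only [Pi.add_apply, Finset.sum_apply, Pi.sub_apply, Sum.elim_inl, Sum.elim_inr]
    rw [← Finset.sum_add_distrib, add_assoc (a * t + b), ← Finset.sum_add_distrib]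
    congr 1
    refine Finset.sum_congr rfl fun q _ => ?_
    rw [h₁, h₂, Finset.sum_range, Finset.sum_range]
    have : ∑ k : Fin (3 * W), c (q, k) * relu (t - y (q, k)) =
        ∑ k : Fin (3 * W), relu (coef q k) * relu (t - x (idx q k)) -
        ∑ k : Fin (3 * W), relu (-coef q k) * relu (t - x (idx q k)) := by
      rw [← Finset.sum_sub_distrib]
      refine Finset.sum_congr rfl fun k _ => ?_
      have hk : coef q k = c (q, k) := by simp [coef]
      rw [hk, ← sub_mul]
      congr 1
      rcases le_total 0 (c (q, k)) with h | h
      · rw [relu_of_nonneg h, relu_of_nonpos (by linarith)]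
        ring
      · rw [relu_of_nonpos h, relu_of_nonneg (by linarith)]
        ring
    rw [this]
    ring

/-! ### Networks -/

/-- Affine functionals on `ℝ^n`. -/
def IsAffineFun {n : ℕ} (f : (Fin n → ℝ) → ℝ) : Prop :=
  ∃ (m : Fin n → ℝ) (c : ℝ), ∀ x, f x = (∑ j, m j * x j) + c

lemma isAffineMap_iff {n m : ℕ} {A : (Fin n → ℝ) → (Fin m → ℝ)} :
    IsAffineMap A ↔ ∀ i, IsAffineFun fun x => A x i := by
  constructor
  · rintro ⟨M, c, h⟩ i
    exact ⟨M i, c i, fun x => h x i⟩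
  · intro h
    choose M c h using h
    exact ⟨M, c, fun x i => h i x⟩

namespace IsAffineFun

variable {n : ℕ} {f g : (Fin n → ℝ) → ℝ}

lemma const (c : ℝ) : IsAffineFun fun _ : Fin n → ℝ => c := ⟨0, c, by simp⟩

lemma coord (j : Fin n) : IsAffineFun fun x => x j :=
  ⟨Pi.single j 1, 0, fun x => by simp [Pi.single_apply]⟩

lemma add (hf : IsAffineFun f) (hg : IsAffineFun g) : IsAffineFun fun x => f x + g x := by
  obtain ⟨m, c, h⟩ := hf
  obtain ⟨m', c', h'⟩ := hg
  refine ⟨m + m', c + c', fun x => ?_⟩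
  simp only [h, h', Pi.add_apply, add_mul, Finset.sum_add_distrib]
  ring

lemma const_mul (a : ℝ) (hf : IsAffineFun f) : IsAffineFun fun x => a * f x := by
  obtain ⟨m, c, h⟩ := hf
  refine ⟨fun j => a * m j, a * c, fun x => ?_⟩
  simp only [h, mul_add, Finset.mul_sum, mul_assoc]

lemma sum {ι : Type*} (s : Finset ι) {F : ι → (Fin n → ℝ) → ℝ} (h : ∀ i, IsAffineFun (F i)) :
    IsAffineFun fun x => ∑ i ∈ s, F i x := by
  classical
  induction s using Finset.induction_on with
  | empty => simpa using const 0
  | insert i s hi ih =>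
    simp only [Finset.sum_insert hi]
    exact (h i).add ih

lemma comp {m : ℕ} {A : (Fin m → ℝ) → (Fin n → ℝ)} (hf : IsAffineFun f) (hA : IsAffineMap A) :
    IsAffineFun fun x => f (A x) := by
  obtain ⟨c, d, h⟩ := hf
  simp only [h]
  exact (sum _ fun j => (isAffineMap_iff.1 hA j).const_mul _).add (const d)

end IsAffineFun

lemma NNaux_comp {k W L d N : ℕ} {h : (Fin N → ℝ) → (Fin k → ℝ)} (hh : h ∈ NNaux k W L N)
    {A : (Fin d → ℝ) → (Fin N → ℝ)} (hA : IsAffineMap A) :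
    (fun x => h (A x)) ∈ NNaux k W L d := by
  cases L with
  | zero => exact isAffineMap_iff.2 fun i => (isAffineMap_iff.1 hh i).comp hA
  | succ L =>
    obtain ⟨N', h1, h2, A', h', hA', hh', rfl⟩ := hh
    exact ⟨N', h1, h2, fun x => A' (A x), h',
      isAffineMap_iff.2 fun i => (isAffineMap_iff.1 hA' i).comp hA, hh', rfl⟩

/-- Prepending a hidden layer. -/
lemma NNaux_layer {k W L d N : ℕ} {h : (Fin N → ℝ) → (Fin k → ℝ)} (hh : h ∈ NNaux k W L N)
    (h1 : 1 ≤ N) (h2 : N ≤ W) {A : (Fin d → ℝ) → (Fin N → ℝ)} (hA : IsAffineMap A) :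
    (fun x => h fun i => relu (A x i)) ∈ NNaux k W (L + 1) d :=
  ⟨N, h1, h2, A, h, hA, hh, rfl⟩

/-- A function in `PL (Set.range ξ)` is an affine function of the first hidden layer. -/
lemma exists_affine_of_mem_PL {m : ℕ} {ξ : Fin m → ℝ} {q : ℝ → ℝ} (hq : q ∈ PL (Set.range ξ))
    (α : ℝ) : ∃ A : (Fin (m + 2) → ℝ) → ℝ, IsAffineFun A ∧ ∀ z t,
      z 0 = t - α → (∀ j : Fin m, z j.succ.succ = relu (t - ξ j)) → A z = q t := by
  obtain ⟨a, b, c, h⟩ := exists_coeff_of_mem_PL hq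
  refine ⟨fun z => a * (z 0 + α) + b + ∑ j : Fin m, c j * z j.succ.succ,
    ((((IsAffineFun.coord 0).add (.const α)).const_mul a).add (.const b)).add
      (.sum _ fun j => (IsAffineFun.coord j.succ.succ).const_mul (c j)), fun z t h0 hz => ?_⟩
  simp only [h0, hz, h, sub_add_cancel]

/-- Two hidden layers that keep the input `t` and add `p + ∑ k, ε k * relu ∘ g k` to the
accumulated value `c`. -/
lemma exists_block {W l m M : ℕ} (hm : m + 2 ≤ W) (hM : M + 2 ≤ W) {ξ : Fin m → ℝ}
    {g : Fin M → ℝ → ℝ} (ε : Fin M → ℝ) {p : ℝ → ℝ} (hg : ∀ k, g k ∈ PL (Set.range ξ))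
    (hp : p ∈ PL (Set.range ξ)) (α β B : ℝ) {h : (Fin 2 → ℝ) → (Fin 1 → ℝ)}
    (hh : h ∈ NNaux 1 W l 2) :
    ∃ H ∈ NNaux 1 W (l + 2) 2, ∀ t ∈ Set.Icc α β, ∀ c, |c| ≤ B →
      H ![t, c] = h ![t, c + (p t + ∑ k, ε k * relu (g k t))] := by
  obtain ⟨C, hC⟩ := PL_bounded hp α β
  obtain ⟨p', hp', hpp⟩ := exists_affine_of_mem_PL hp α
  choose g' hg' hgg using fun k => exists_affine_of_mem_PL (hg k) α
  let A₀ : (Fin 2 → ℝ) → (Fin (m + 2) → ℝ) := fun z =>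
    Fin.cons (z 0 + -α) (Fin.cons (z 1 + B) fun j => z 0 + -ξ j)
  have hA₀ : IsAffineMap A₀ := isAffineMap_iff.2 fun i => by
    refine Fin.cases ?_ (fun i => Fin.cases ?_ (fun i => ?_) i) i
    · exact (IsAffineFun.coord 0).add (.const _)
    · exact (IsAffineFun.coord 1).add (.const _)
    · exact (IsAffineFun.coord 0).add (.const _)
  let A₁ : (Fin (m + 2) → ℝ) → (Fin (M + 2) → ℝ) := fun z =>
    Fin.cons (z 0) (Fin.cons (z 1 + (p' z + C)) fun k => g' k z)
  have hA₁ : IsAffineMap A₁ := isAffineMap_iff.2 fun i => by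
    refine Fin.cases ?_ (fun i => Fin.cases ?_ (fun i => ?_) i) i
    · exact IsAffineFun.coord 0
    · exact (IsAffineFun.coord 1).add (hp'.add (.const _))
    · exact hg' i
  let A₂ : (Fin (M + 2) → ℝ) → (Fin 2 → ℝ) := fun z =>
    ![z 0 + α, (z 1 + -(B + C)) + ∑ k : Fin M, ε k * z k.succ.succ]
  have hA₂ : IsAffineMap A₂ := isAffineMap_iff.2 fun i => by
    fin_cases i
    · exact (IsAffineFun.coord 0).add (.const _)
    · exact ((IsAffineFun.coord 1).add (.const _)).add
        (.sum _ fun k => (IsAffineFun.coord _).const_mul _)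
  refine ⟨_, NNaux_layer (NNaux_layer (NNaux_comp hh hA₂) (by omega) hM hA₁) (by omega) hm hA₀,
    fun t ht c hc => ?_⟩
  have hα : relu (t + -α) = t - α := relu_of_nonneg (by linarith [ht.1])
  have hB : relu (c + B) = c + B := relu_of_nonneg (by linarith [(abs_le.1 hc).1])
  set z : Fin (m + 2) → ℝ := fun i => relu (A₀ ![t, c] i)
  have z0 : z 0 = t - α := hα
  have z1 : z 1 = c + B := hB
  have zj : ∀ j : Fin m, z j.succ.succ = relu (t - ξ j) := fun j => rfl
  have hpz : p' z = p t := hpp z t z0 zj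
  have w0 : relu (A₁ z 0) = t - α := by
    change relu (z 0) = _
    rw [z0, relu_of_nonneg (by linarith [ht.1])]
  have w1 : relu (A₁ z 1) = c + B + (p t + C) := by
    change relu (z 1 + (p' z + C)) = _
    rw [z1, hpz, relu_of_nonneg
      (by linarith [(abs_le.1 hc).1, (abs_le.1 (hC t ht)).1])]
  have wk : ∀ k : Fin M, relu (A₁ z k.succ.succ) = relu (g k t) := fun k => by
    change relu (g' k z) = _
    rw [hgg k z t z0 zj]
  congr 1
  simp only [A₂, w0, w1, wk]
  congr 1
  · ring
  · congr 1
    ring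

lemma exists_network (W : ℕ) (α β : ℝ) (L : ℕ) : ∀ (S : Finset ℝ), S.card ≤ 6 * W ^ 2 * L →
    ∀ T ∈ PL S, ∀ B : ℝ, ∃ h ∈ NNaux 1 (6 * W + 2) (2 * L) 2,
      ∀ t ∈ Set.Icc α β, ∀ c, |c| ≤ B → h ![t, c] 0 = c + T t := by
  induction L with
  | zero =>
    intro S hS T hT B
    obtain rfl : S = ∅ := by simpa using hS
    obtain ⟨a, b, c, h⟩ := exists_coeff_of_mem_PL (y := (Fin.elim0 : Fin 0 → ℝ))
      (PL_mono (by simp) hT)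
    refine ⟨fun z _ => z 1 + (a * z 0 + b), isAffineMap_iff.2 fun _ =>
      (IsAffineFun.coord 1).add (((IsAffineFun.coord 0).const_mul a).add (.const b)),
      fun t _ c _ => by simp [h]⟩
  | succ L ih =>
    intro S hS T hT B
    obtain ⟨S₁, hS₁, hcard⟩ := Finset.exists_subset_card_eq (min_le_left S.card (6 * W ^ 2))
    have hT' : T ∈ PL (S₁ ∪ (S \ S₁ : Finset ℝ)) := by
      convert hT
      rw [← Finset.coe_union, Finset.union_sdiff_of_subset hS₁]
    obtain ⟨T₁, hT₁, T₂, hT₂, rfl⟩ := Submodule.mem_sup.1 (PL_union _ _ hT')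
    obtain ⟨C, hC⟩ := PL_bounded hT₁ α β
    obtain ⟨h, hh, hh'⟩ := ih (S \ S₁) (by
      rw [Finset.card_sdiff_of_subset hS₁, hcard]
      rw [mul_add] at hS
      omega) T₂ hT₂ (B + C)
    obtain ⟨ξ, M, g, ε, p, hM, hg, hp, hsum⟩ :=
      exists_two_layer (hcard.trans_le (min_le_right _ _)) hT₁
    obtain ⟨H, hH, hH'⟩ := exists_block le_rfl (by omega) ε hg hp α β B hh
    refine ⟨H, hH, fun t ht c hc => ?_⟩
    rw [hH' t ht c hc, ← hsum, hh' t ht _ ((abs_add_le _ _).trans (add_le_add hc (hC t ht))),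
      Pi.add_apply, add_assoc]

theorem pwl_deep_realization (W L n : ℕ) (hW : 1 ≤ W) (hL : 1 ≤ L)
    (α β : ℝ) (hαβ : α ≤ β) (g : ℝ → ℝ) (hg : IsPWL (n + 1) g)
    (hbp : ∀ x : ℝ, ¬ DifferentiableAt ℝ g x → x ∈ Set.Icc α β)
    (hn : n ≤ 6 * W ^ 2 * L) :
    ∃ f ∈ NN 1 1 (6 * W + 2) (2 * L), ∀ t ∈ Set.Icc α β, f (fun _ => t) 0 = g t := by
  obtain ⟨S, hS, T, hT, hgT⟩ := hg.exists_PL_eqOn hαβ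
  obtain ⟨h, hh, hh'⟩ := exists_network W α β L S (hS.trans hn) T hT 0
  have hA : IsAffineMap fun x : Fin 1 → ℝ => ![x 0, 0] := isAffineMap_iff.2 fun i => by
    fin_cases i
    · exact IsAffineFun.coord 0
    · exact IsAffineFun.const 0
  refine ⟨_, NNaux_comp hh hA, fun t ht => ?_⟩
  rw [hgT t ht, hh' t ht 0 (by simp), zero_add]
end

section
/- (Bit extraction, one step) Let m, n ∈ ℕ satisfy 1 ≤ m ≤ n. There exists f ∈ NN_{1,m+1}(2^{m+2}+1, 1) such that for all x₁, …, x_n ∈ {0,1}, f(Σ_{i=1}^n 2^{−i} x_i) = (x₁, x₂, …, x_m, Σ_{i=m+1}^n 2^{m−i} x_i) ∈ ℝ^{m+1}. -/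
open MeasureTheory ENNReal Finset

/-- A one-hidden-layer ReLU network whose neurons are indexed by an arbitrary nonempty finite type. -/
lemma sum_relu_mem_NN {ι : Type*} [Fintype ι] {k W : ℕ} (h_pos : 1 ≤ Fintype.card ι)
    (hW : Fintype.card ι ≤ W) (M : Fin k → ι → ℝ) (c : Fin k → ℝ) (a b : ι → ℝ) :
    (fun (x : Fin 1 → ℝ) j => (∑ i, M j i * relu (a i * x 0 + b i)) + c j) ∈ NN 1 k W 1 := by
  let e := Fintype.equivFin ι
  refine ⟨Fintype.card ι, h_pos, hW, fun x i => a (e.symm i) * x 0 + b (e.symm i),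
    fun y j => (∑ i, M j (e.symm i) * y i) + c j,
    ⟨fun i _ => a (e.symm i), fun i => b (e.symm i), fun x i => by simp⟩,
    ⟨fun j i => M j (e.symm i), c, fun _ _ => rfl⟩, ?_⟩
  funext x j
  congr 1
  exact (Equiv.sum_comp e.symm fun i => M j i * relu (a i * x 0 + b i)).symm

/-- The ramp from `0` at `k + 1 - ε` to `1` at `k + 1` is a step on points `K + r` with
`r ∈ [0, 1 - ε]`. -/
lemma ramp_eq_ite {ε r : ℝ} (hε : 0 < ε) (hr0 : 0 ≤ r) (hr1 : r ≤ 1 - ε) (K k : ℕ) :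
    ε⁻¹ * (relu (K + r - (k + 1 - ε)) - relu (K + r - (k + 1))) = if k < K then 1 else 0 := by
  unfold relu
  split_ifs with h
  · have h' : (k : ℝ) + 1 ≤ K := by exact_mod_cast h
    rw [max_eq_left (by linarith), max_eq_left (by linarith)]
    field_simp
    ring
  · have h' : (K : ℝ) ≤ k := by exact_mod_cast not_lt.mp h
    rw [max_eq_right (by linarith), max_eq_right (by linarith)]
    simp

/-- Interpolation of a sequence `v` at the integer part by a sum of ramps. -/
lemma sum_ramp_eq {ε r : ℝ} (hε : 0 < ε) (hr0 : 0 ≤ r) (hr1 : r ≤ 1 - ε) {K P : ℕ} (hK : K ≤ P)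
    (v : ℕ → ℝ) :
    (∑ k : Fin P, (v (k + 1) - v k) *
      (ε⁻¹ * (relu (K + r - ((k : ℕ) + 1 - ε)) - relu (K + r - ((k : ℕ) + 1))))) + v 0 = v K := by
  simp_rw [ramp_eq_ite hε hr0 hr1]
  rw [← Finset.sum_range fun k => (v (k + 1) - v k) * (if k < K then (1 : ℝ) else 0)]
  simp_rw [mul_ite, mul_one, mul_zero]
  rw [← Finset.sum_filter]
  have : (Finset.range P).filter (· < K) = Finset.range K := by
    ext k
    simp only [Finset.mem_filter, Finset.mem_range]
    omega
  rw [this, Finset.sum_range_sub]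
  ring

/-- The natural number whose binary digits, most significant first, are `X 0, …, X (m - 1)`. -/
def natOfBits (X : ℕ → ℕ) : ℕ → ℕ
  | 0 => 0
  | m + 1 => 2 * natOfBits X m + X m

lemma natOfBits_lt {X : ℕ → ℕ} (hX : ∀ i, X i ≤ 1) (m : ℕ) : natOfBits X m < 2 ^ m := by
  induction m with
  | zero => simp [natOfBits]
  | succ m ih =>
    have := hX m
    rw [natOfBits, pow_succ]
    omega

lemma natOfBits_add_div {X : ℕ → ℕ} (hX : ∀ i, X i ≤ 1) (j d : ℕ) :
    natOfBits X (j + d) / 2 ^ d = natOfBits X j := by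
  induction d with
  | zero => simp
  | succ d ih =>
    have := hX (j + d)
    rw [← add_assoc, natOfBits, pow_succ', ← Nat.div_div_eq_div_mul]
    rwa [show (2 * natOfBits X (j + d) + X (j + d)) / 2 = natOfBits X (j + d) by omega]

lemma natOfBits_bit {X : ℕ → ℕ} (hX : ∀ i, X i ≤ 1) {j m : ℕ} (hj : j < m) :
    natOfBits X m / 2 ^ (m - 1 - j) % 2 = X j := by
  have := natOfBits_add_div hX (j + 1) (m - 1 - j)
  rw [show j + 1 + (m - 1 - j) = m by omega] at this
  have := hX j
  rw [‹natOfBits X m / _ = _›, natOfBits]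
  omega

lemma two_pow_mul_sum_bits (X : ℕ → ℕ) (m : ℕ) :
    (2 : ℝ) ^ m * ∑ i ∈ Finset.range m, (2 : ℝ) ^ (-(i : ℤ) - 1) * X i = natOfBits X m := by
  induction m with
  | zero => simp [natOfBits]
  | succ m ih =>
    have h : (2 : ℝ) ^ (m + 1) * (2 : ℝ) ^ (-(m : ℤ) - 1) = 1 := by
      rw [← zpow_natCast, ← zpow_add₀ two_ne_zero]
      simp
    rw [Finset.sum_range_succ, mul_add, ← mul_assoc ((2 : ℝ) ^ (m + 1)) _ (X m : ℝ), h, pow_succ',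
      mul_assoc, ih, natOfBits]
    push_cast
    ring

lemma sum_bits_le {X : ℕ → ℕ} (hX : ∀ i, X i ≤ 1) (p : ℕ) :
    ∑ i ∈ Finset.range p, (2 : ℝ) ^ (-(i : ℤ) - 1) * X i ≤ 1 - (2 : ℝ) ^ (-(p : ℤ)) := by
  induction p with
  | zero => simp
  | succ p ih =>
    have hx : (X p : ℝ) ≤ 1 := by exact_mod_cast hX p
    have h : (2 : ℝ) ^ (-(p : ℤ)) = 2 * (2 : ℝ) ^ (-(p : ℤ) - 1) := by
      rw [zpow_sub_one₀ two_ne_zero]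
      ring
    have h0 : (0 : ℝ) < (2 : ℝ) ^ (-(p : ℤ) - 1) := by positivity
    rw [Finset.sum_range_succ, show -((p + 1 : ℕ) : ℤ) = -(p : ℤ) - 1 by push_cast; ring]
    nlinarith

theorem bit_extraction_one_step (m n : ℕ) (hm : 1 ≤ m) (hmn : m ≤ n) :
    ∃ f ∈ NN 1 (m + 1) (2 ^ (m + 2) + 1) 1,
      ∀ x : Fin n → ℝ, (∀ i, x i = 0 ∨ x i = 1) →
        ∀ j : Fin (m + 1),
          f (fun _ => ∑ i : Fin n, (2 : ℝ) ^ (-(i : ℤ) - 1) * x i) j =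
            if h : (j : ℕ) < m then x ⟨j, lt_of_lt_of_le h hmn⟩
            else ∑ i : Fin n, if m ≤ (i : ℕ) then (2 : ℝ) ^ ((m : ℤ) - (i : ℤ) - 1) * x i else 0 := by
  obtain ⟨p, rfl⟩ := Nat.exists_eq_add_of_le hmn
  let ε : ℝ := (2 : ℝ) ^ (-(p : ℤ))
  have hε : 0 < ε := by positivity
  let v : Fin (m + 1) → ℕ → ℝ := fun j k =>
    if (j : ℕ) < m then ((k / 2 ^ (m - 1 - j) % 2 : ℕ) : ℝ) else -(k : ℝ)
  let u : Fin (m + 1) → ℝ := fun j => if (j : ℕ) < m then 0 else 1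
  refine ⟨_, sum_relu_mem_NN (ι := Option (Fin (2 ^ m) ⊕ Fin (2 ^ m))) (by simp)
    (by simp only [Fintype.card_option, Fintype.card_sum, Fintype.card_fin, pow_succ]; omega)
    (fun j i => i.elim (u j) (Sum.elim (fun k => (v j (k + 1) - v j k) * ε⁻¹)
      fun k => -((v j (k + 1) - v j k) * ε⁻¹)))
    (fun j => v j 0) (fun _ => 2 ^ m)
    (fun i => i.elim 0 (Sum.elim (fun k => -((k : ℕ) + 1 - ε)) fun k => -((k : ℕ) + 1))), ?_⟩
  intro x hx j
  obtain ⟨X, hX, hxX⟩ : ∃ X : ℕ → ℕ, (∀ i, X i ≤ 1) ∧ ∀ i : Fin (m + p), x i = X i := by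
    refine ⟨fun i => if h : i < m + p then if x ⟨i, h⟩ = 1 then 1 else 0 else 0,
      fun i => by dsimp only; split_ifs <;> simp, fun i => ?_⟩
    rcases hx i with h | h <;> simp [h]
  set r : ℝ := ∑ i ∈ Finset.range p, (2 : ℝ) ^ (-(i : ℤ) - 1) * X (m + i) with hr
  have hr0 : 0 ≤ r := Finset.sum_nonneg fun i _ => by positivity
  have hr1 : r ≤ 1 - ε := sum_bits_le (X := fun i => X (m + i)) (fun i => hX _) p
  have hs : (2 : ℝ) ^ m * ∑ i : Fin (m + p), (2 : ℝ) ^ (-(i : ℤ) - 1) * x i =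
      natOfBits X m + r := by
    simp_rw [hxX]
    rw [← Finset.sum_range fun i => (2 : ℝ) ^ (-(i : ℤ) - 1) * (X i : ℝ), Finset.sum_range_add,
      mul_add, two_pow_mul_sum_bits, hr, Finset.mul_sum]
    congr 1
    refine Finset.sum_congr rfl fun i _ => ?_
    rw [← mul_assoc, ← zpow_natCast, ← zpow_add₀ two_ne_zero]
    congr 2
    push_cast
    ring
  have hrest : (∑ i : Fin (m + p),
      if m ≤ (i : ℕ) then (2 : ℝ) ^ ((m : ℤ) - (i : ℤ) - 1) * x i else 0) = r := by
    simp_rw [hxX]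
    rw [← Finset.sum_range fun i =>
      if m ≤ i then (2 : ℝ) ^ ((m : ℤ) - (i : ℤ) - 1) * (X i : ℝ) else 0, Finset.sum_range_add,
      Finset.sum_eq_zero fun i hi => if_neg (not_le.mpr (Finset.mem_range.mp hi)), zero_add]
    refine Finset.sum_congr rfl fun i _ => ?_
    rw [if_pos (Nat.le_add_right m i)]
    congr 2
    push_cast
    ring
  have hv := sum_ramp_eq hε hr0 hr1 (natOfBits_lt hX m).le (v j)
  have hrelu : relu (natOfBits X m + r) = natOfBits X m + r := max_eq_left (by positivity)
  simp only [Fintype.sum_option, Fintype.sum_sum_type, Option.elim, Sum.elim_inl, Sum.elim_inr,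
    hs, hrest, add_zero, hrelu, ← sub_eq_add_neg]
  have key : u j * (natOfBits X m + r) + v j (natOfBits X m) =
      if h : (j : ℕ) < m then x ⟨j, lt_of_lt_of_le h hmn⟩ else r := by
    by_cases h : (j : ℕ) < m
    · simp [u, v, h, natOfBits_bit hX h, hxX]
    · simp [u, v, h]
  rw [← key, ← hv, ← Finset.sum_add_distrib, add_assoc]
  congr 2
  refine Finset.sum_congr rfl fun k _ => ?_
  ring
end

section
/- (Bit extraction, depth L) Let m, n, L ∈ ℕ satisfy 1 ≤ m ≤ n and L ≥ 1. There exists f ∈ NN_{1,2}(2^{⌈m/L⌉+2}+2, L) such that for all x₁, …, x_n ∈ {0,1}, f(Σ_{i=1}^n 2^{−i} x_i) = (Σ_{i=1}^m 2^{m−i} x_i, Σ_{i=m}^n 2^{m−1−i} x_i) ∈ ℝ². -/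
open MeasureTheory ENNReal Finset

/-- `f` is an affine functional `ℝ^n → ℝ`. -/
def IsAffineFunctional {n : ℕ} (f : (Fin n → ℝ) → ℝ) : Prop :=
  ∃ (v : Fin n → ℝ) (c : ℝ), ∀ x, f x = (∑ j, v j * x j) + c

namespace IsAffineFunctional

variable {n : ℕ} {f g : (Fin n → ℝ) → ℝ}

lemma const (c : ℝ) : IsAffineFunctional (fun _ : Fin n → ℝ => c) :=
  ⟨0, c, fun x => by simp⟩

lemma coord (i : Fin n) : IsAffineFunctional (fun x : Fin n → ℝ => x i) :=
  ⟨Pi.single i 1, 0, fun x => by simp [Pi.single_apply]⟩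

lemma add (hf : IsAffineFunctional f) (hg : IsAffineFunctional g) :
    IsAffineFunctional (fun x => f x + g x) := by
  obtain ⟨v, c, h⟩ := hf
  obtain ⟨w, b, h'⟩ := hg
  refine ⟨v + w, c + b, fun x => ?_⟩
  simp only [h, h', Pi.add_apply, add_mul, Finset.sum_add_distrib]
  ring

lemma const_mul (a : ℝ) (hf : IsAffineFunctional f) :
    IsAffineFunctional (fun x => a * f x) := by
  obtain ⟨v, c, h⟩ := hf
  refine ⟨fun j => a * v j, a * c, fun x => ?_⟩
  simp only [h, mul_add, Finset.mul_sum, mul_assoc]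

lemma sub (hf : IsAffineFunctional f) (hg : IsAffineFunctional g) :
    IsAffineFunctional (fun x => f x - g x) := by
  convert hf.add (hg.const_mul (-1)) using 2
  ring

lemma sum {ι : Type*} (s : Finset ι) {F : ι → (Fin n → ℝ) → ℝ}
    (hF : ∀ i, IsAffineFunctional (F i)) :
    IsAffineFunctional (fun x => ∑ i ∈ s, F i x) := by
  classical
  induction s using Finset.induction_on with
  | empty => simpa using const 0
  | insert a s ha ih =>
    simp only [Finset.sum_insert ha]
    exact (hF a).add ih

end IsAffineFunctional

lemma isAffineMap_of_forall {n m : ℕ} {A : (Fin n → ℝ) → (Fin m → ℝ)}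
    (h : ∀ i, IsAffineFunctional (fun x => A x i)) : IsAffineMap A := by
  choose v c hvc using h
  exact ⟨v, c, fun x i => hvc i x⟩

/-- A point of the dyadic grid `2^{-n} ℤ ∩ [0, 1)`. -/
def IsDyadicPoint (n : ℕ) (z : ℝ) : Prop :=
  0 ≤ z ∧ z < 1 ∧ ∃ p : ℤ, (2 : ℝ) ^ n * z = p

lemma IsDyadicPoint.fract_two_pow_mul {n : ℕ} {z : ℝ} (hz : IsDyadicPoint n z) (s : ℕ) :
    IsDyadicPoint n (Int.fract (2 ^ s * z)) := by
  obtain ⟨-, -, p, hp⟩ := hz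
  refine ⟨Int.fract_nonneg _, Int.fract_lt_one _, 2 ^ s * p - 2 ^ n * ⌊(2 : ℝ) ^ s * z⌋, ?_⟩
  rw [Int.fract]
  push_cast
  rw [← hp]
  ring

/-- The difference of two ReLUs is a unit step at `c / 2^s` on the dyadic grid. -/
lemma relu_sub_relu_eq_ite {n s : ℕ} (hs : s ≤ n) {z : ℝ} (hz : IsDyadicPoint n z) (c : ℤ) :
    2 ^ n * (relu (z - c / 2 ^ s + 1 / 2 ^ n) - relu (z - c / 2 ^ s)) =
      if c ≤ ⌊(2 : ℝ) ^ s * z⌋ then 1 else 0 := by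
  have hpos : (0 : ℝ) < 2 ^ s := by positivity
  have hposn : (0 : ℝ) < 2 ^ n := by positivity
  have hδ : (0 : ℝ) < 1 / 2 ^ n := by positivity
  split_ifs with h
  · rw [Int.le_floor] at h
    have h1 : (c : ℝ) / 2 ^ s ≤ z := by
      rw [div_le_iff₀ hpos]
      linarith
    rw [relu_of_nonneg (by linarith), relu_of_nonneg (by linarith)]
    field_simp
    ring
  · rw [Int.le_floor, not_le] at h
    obtain ⟨-, -, p, hp⟩ := hz
    have h2 : (p : ℝ) < c * 2 ^ (n - s) := by
      rw [← hp, ← Nat.sub_add_cancel hs, pow_add, Nat.sub_add_cancel hs]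
      nlinarith [pow_pos (zero_lt_two' ℝ) (n - s)]
    have h3 : (p : ℝ) + 1 ≤ c * 2 ^ (n - s) := by exact_mod_cast h2
    have h4 : z + 1 / 2 ^ n ≤ c / 2 ^ s := by
      have e1 : z + 1 / 2 ^ n = (p + 1) / 2 ^ n := by
        rw [← hp]
        field_simp
      have e2 : (c : ℝ) / 2 ^ s = c * 2 ^ (n - s) / 2 ^ n := by
        rw [div_eq_div_iff hpos.ne' hposn.ne', mul_assoc, ← pow_add, Nat.sub_add_cancel hs]
      rw [e1, e2]
      gcongr
    rw [relu_of_nonpos (by linarith), relu_of_nonpos (by linarith)]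
    simp

/-- On the dyadic grid, the staircase `z ↦ ⌊2^s z⌋` is a combination of `2 * 2^s` ReLUs. -/
lemma sum_relu_eq_floor {n s : ℕ} (hs : s ≤ n) {z : ℝ} (hz : IsDyadicPoint n z) :
    ∑ j : Fin (2 ^ s), 2 ^ n * (relu (z - ((j : ℤ) + 1 : ℤ) / 2 ^ s + 1 / 2 ^ n) -
      relu (z - ((j : ℤ) + 1 : ℤ) / 2 ^ s)) = (⌊(2 : ℝ) ^ s * z⌋ : ℝ) := by
  simp_rw [relu_sub_relu_eq_ite hs hz]
  obtain ⟨h0, h1, -⟩ := hz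
  have hq0 : 0 ≤ ⌊(2 : ℝ) ^ s * z⌋ := Int.floor_nonneg.2 (by positivity)
  have hq1 : ⌊(2 : ℝ) ^ s * z⌋ < 2 ^ s := by
    rw [Int.floor_lt]
    push_cast
    nlinarith [pow_pos (zero_lt_two' ℝ) s]
  obtain ⟨q, hq⟩ := Int.eq_ofNat_of_zero_le hq0
  rw [hq] at hq1 ⊢
  have hq2 : q < 2 ^ s := by exact_mod_cast hq1
  rw [Fin.sum_univ_eq_sum_range (fun j : ℕ => if (j : ℤ) + 1 ≤ (q : ℤ) then (1 : ℝ) else 0),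
    ← Finset.sum_filter]
  have : (Finset.range (2 ^ s)).filter (fun j : ℕ => (j : ℤ) + 1 ≤ (q : ℤ)) = Finset.range q := by
    ext j
    simp only [Finset.mem_filter, Finset.mem_range]
    omega
  rw [this]
  simp

/-- One hidden ReLU layer from which `u`, `v` and two staircases of `u` can be read off affinely. -/
lemma exists_staircase_layer {n k s t d : ℕ} (hsk : s ≤ k) (htk : t ≤ k) (hsn : s ≤ n)
    (htn : t ≤ n) {u v : (Fin d → ℝ) → ℝ} (hu : IsAffineFunctional u)
    (hv : IsAffineFunctional v) :
    ∃ N : ℕ, 1 ≤ N ∧ N ≤ 2 ^ (k + 2) + 2 ∧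
      ∃ (A : (Fin d → ℝ) → (Fin N → ℝ)) (U V S T : (Fin N → ℝ) → ℝ), IsAffineMap A ∧
        IsAffineFunctional U ∧ IsAffineFunctional V ∧ IsAffineFunctional S ∧
        IsAffineFunctional T ∧
        ∀ y, IsDyadicPoint n (u y) → 0 ≤ v y →
          U (fun i => relu (A y i)) = u y ∧ V (fun i => relu (A y i)) = v y ∧
          S (fun i => relu (A y i)) = (⌊(2 : ℝ) ^ s * u y⌋ : ℝ) ∧
          T (fun i => relu (A y i)) = (⌊(2 : ℝ) ^ t * u y⌋ : ℝ) := by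
  let ι := Bool ⊕ (Bool × Fin (2 ^ s)) ⊕ (Bool × Fin (2 ^ t))
  let e : ι ≃ Fin (Fintype.card ι) := Fintype.equivFin ι
  have hcard : Fintype.card ι = 2 + (2 * 2 ^ s + 2 * 2 ^ t) := by simp [ι]
  let knot (r j : ℕ) : ℝ := ((j : ℤ) + 1 : ℤ) / 2 ^ r
  let step (r : ℕ) (b : Bool) (j : ℕ) (y : Fin d → ℝ) : ℝ :=
    if b then u y - knot r j + 1 / 2 ^ n else u y - knot r j
  have hstep : ∀ r b j, IsAffineFunctional (step r b j) := by
    intro r b j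
    have h := hu.sub (IsAffineFunctional.const (knot r j))
    cases b
    · simpa [step] using h
    · simpa [step] using h.add (IsAffineFunctional.const (1 / 2 ^ n))
  let B : ι → (Fin d → ℝ) → ℝ := Sum.elim (fun b => if b then u else v)
    (Sum.elim (fun p => step s p.1 p.2) (fun p => step t p.1 p.2))
  have hB : ∀ i, IsAffineFunctional (B i) := by
    rintro ((_ | _) | ⟨b, j⟩ | ⟨b, j⟩)
    · simpa [B] using hv
    · simpa [B] using hu
    · exact hstep s b j
    · exact hstep t b j
  have hs2 : 2 ^ s ≤ 2 ^ k := Nat.pow_le_pow_right two_pos hsk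
  have ht2 : 2 ^ t ≤ 2 ^ k := Nat.pow_le_pow_right two_pos htk
  refine ⟨Fintype.card ι, by omega, by rw [hcard, pow_add]; omega,
    fun y i => B (e.symm i) y, fun w => w (e (.inl true)), fun w => w (e (.inl false)),
    fun w => ∑ j, 2 ^ n * (w (e (.inr (.inl (true, j)))) - w (e (.inr (.inl (false, j))))),
    fun w => ∑ j, 2 ^ n * (w (e (.inr (.inr (true, j)))) - w (e (.inr (.inr (false, j))))),
    isAffineMap_of_forall fun i => hB _, .coord _, .coord _,
    .sum _ fun j => .const_mul _ (.sub (.coord _) (.coord _)),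
    .sum _ fun j => .const_mul _ (.sub (.coord _) (.coord _)), ?_⟩
  intro y hy hvy
  simp only [Equiv.symm_apply_apply]
  exact ⟨relu_of_nonneg hy.1, relu_of_nonneg hvy, sum_relu_eq_floor hsn hy,
    sum_relu_eq_floor htn hy⟩

/-- A network of depth `L + 1` appending the first `r` bits of `u` to `v` and returning the
remaining bits of `u`, starting from the `r`-th one. -/
lemma exists_bit_extraction_network {n k : ℕ} (hk : 1 ≤ k) (L : ℕ) :
    ∀ {r d : ℕ} {u v : (Fin d → ℝ) → ℝ}, 1 ≤ r → r ≤ (L + 1) * k → r ≤ n →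
      IsAffineFunctional u → IsAffineFunctional v →
      ∃ g ∈ NNaux 2 (2 ^ (k + 2) + 2) (L + 1) d, ∀ y, IsDyadicPoint n (u y) → 0 ≤ v y →
        g y 0 = 2 ^ r * v y + (⌊(2 : ℝ) ^ r * u y⌋ : ℝ) ∧
        g y 1 = Int.fract (2 ^ (r - 1) * u y) := by
  induction L with
  | zero =>
    intro r d u v hr hrk hrn hu hv
    obtain ⟨N, hN1, hN2, A, U, V, S, T, hA, hU, hV, hS, hT, h⟩ :=
      exists_staircase_layer (n := n) (k := k) (s := r) (t := r - 1) (by omega) (by omega) hrn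
        (by omega) hu hv
    refine ⟨_, ⟨N, hN1, hN2, A,
      fun w => ![2 ^ r * V w + S w, 2 ^ (r - 1) * U w - T w], hA, ?_, rfl⟩, ?_⟩
    · refine isAffineMap_of_forall fun i => ?_
      fin_cases i
      · exact (hV.const_mul _).add hS
      · exact (hU.const_mul _).sub hT
    · intro y hy hvy
      obtain ⟨h1, h2, h3, h4⟩ := h y hy hvy
      exact ⟨by simp [h2, h3], by
        simp only [Matrix.cons_val_one, Matrix.cons_val_fin_one, h1, h4, Int.fract]⟩
  | succ L ih =>
    intro r d u v hr hrk hrn hu hv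
    obtain ⟨s, r', hsr, hsk, hr', hr'k⟩ :
        ∃ s r', r = s + r' ∧ s ≤ k ∧ 1 ≤ r' ∧ r' ≤ (L + 1) * k := by
      have hLk : 1 ≤ (L + 1) * k := Nat.mul_pos (Nat.succ_pos L) hk
      rw [add_mul (L + 1), one_mul] at hrk
      exact ⟨r - min r ((L + 1) * k), min r ((L + 1) * k), by omega, by omega, by omega,
        by omega⟩
    obtain ⟨N, hN1, hN2, A, U, V, S, _, hA, hU, hV, hS, -, h⟩ :=
      exists_staircase_layer (n := n) (k := k) (s := s) (t := s) hsk hsk (by omega)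
        (by omega) hu hv
    obtain ⟨g, hg, hgy⟩ := ih hr' hr'k (by omega) ((hU.const_mul (2 ^ s)).sub hS)
      ((hV.const_mul (2 ^ s)).add hS)
    refine ⟨_, ⟨N, hN1, hN2, A, g, hA, hg, rfl⟩, ?_⟩
    intro y hy hvy
    obtain ⟨h1, h2, h3, -⟩ := h y hy hvy
    have hfl : 0 ≤ ⌊(2 : ℝ) ^ s * u y⌋ :=
      Int.floor_nonneg.2 (mul_nonneg (by positivity) hy.1)
    have hfl' : (0 : ℝ) ≤ ⌊(2 : ℝ) ^ s * u y⌋ := by exact_mod_cast hfl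
    specialize hgy (fun i => relu (A y i))
    simp only [h1, h2, h3] at hgy
    obtain ⟨e0, e1⟩ := hgy (hy.fract_two_pow_mul s) (by positivity)
    have key : ∀ q : ℕ, (2 : ℝ) ^ q * (2 ^ s * u y - ⌊(2 : ℝ) ^ s * u y⌋) =
        2 ^ (s + q) * u y - (2 ^ q * ⌊(2 : ℝ) ^ s * u y⌋ : ℤ) := by
      intro q
      push_cast
      ring
    rw [key] at e0 e1
    refine ⟨?_, ?_⟩
    · rw [e0, Int.floor_sub_intCast, hsr]
      push_cast
      ring
    · rw [e1, Int.fract_sub_intCast, hsr, Nat.add_sub_assoc hr']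

/-- The binary expansion formed by the bits from index `m` on lies in `[0, 1)`. -/
lemma sum_tail_bits_mem_Ico {m n : ℕ} (hmn : m ≤ n) {x : Fin n → ℝ}
    (hx : ∀ i, x i = 0 ∨ x i = 1) :
    (∑ i : Fin n, if m ≤ (i : ℕ) then (2 : ℝ) ^ ((m : ℤ) - (i : ℤ) - 1) * x i else 0) ∈
      Set.Ico (0 : ℝ) 1 := by
  have hx' : ∀ i, 0 ≤ x i ∧ x i ≤ 1 := fun i => by rcases hx i with h | h <;> simp [h]
  constructor
  · refine Finset.sum_nonneg fun i _ => ?_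
    have := (hx' i).1
    split_ifs <;> positivity
  · have h1 : (∑ i : Fin n, if m ≤ (i : ℕ) then (2 : ℝ) ^ ((m : ℤ) - (i : ℤ) - 1) * x i else 0) ≤
        ∑ i : Fin n, if m ≤ (i : ℕ) then (2 : ℝ) ^ ((m : ℤ) - (i : ℤ) - 1) else 0 := by
      refine Finset.sum_le_sum fun i _ => ?_
      split_ifs
      · exact mul_le_of_le_one_right (by positivity) (hx' i).2
      · rfl
    rw [Fin.sum_univ_eq_sum_range
      (fun i : ℕ => if m ≤ i then (2 : ℝ) ^ ((m : ℤ) - (i : ℤ) - 1) else 0)] at h1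
    have h2 : (∑ i ∈ Finset.range n, if m ≤ i then (2 : ℝ) ^ ((m : ℤ) - (i : ℤ) - 1) else 0) =
        1 - (2 : ℝ) ^ ((m : ℤ) - n) := by
      clear h1 hx' hx x
      induction n, hmn using Nat.le_induction with
      | base =>
        rw [Finset.sum_eq_zero fun i hi => if_neg (by simpa using hi)]
        simp
      | succ n hn ih =>
        rw [Finset.sum_range_succ, ih, if_pos hn]
        have : (2 : ℝ) ^ ((m : ℤ) - n) = 2 ^ ((m : ℤ) - n - 1) * 2 := by
          rw [← zpow_add_one₀ two_ne_zero]
          congr 1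
          ring
        rw [this, Nat.cast_succ, ← sub_sub]
        ring
    have h3 : (0 : ℝ) < 2 ^ ((m : ℤ) - n) := by positivity
    linarith

/-- The integer formed by the bits before index `m` is an integer. -/
lemma exists_int_eq_sum_head_bits (m : ℕ) {n : ℕ} {x : Fin n → ℝ}
    (hx : ∀ i, x i = 0 ∨ x i = 1) :
    ∃ p : ℤ, (∑ i : Fin n, if (i : ℕ) < m then (2 : ℝ) ^ ((m : ℤ) - (i : ℤ) - 1) * x i else 0) =
      p := by
  have : ∀ i : Fin n, ∃ p : ℤ,
      (if (i : ℕ) < m then (2 : ℝ) ^ ((m : ℤ) - (i : ℤ) - 1) * x i else 0) = p := by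
    intro i
    split_ifs with h
    · have e : (2 : ℝ) ^ ((m : ℤ) - (i : ℤ) - 1) = 2 ^ (m - i - 1) := by
        rw [← zpow_natCast]
        congr 1
        omega
      rw [e]
      rcases hx i with h' | h'
      · exact ⟨0, by simp [h']⟩
      · exact ⟨2 ^ (m - i - 1), by simp [h']⟩
    · exact ⟨0, by simp⟩
  choose p hp using this
  exact ⟨∑ i, p i, by rw [Finset.sum_congr rfl fun i _ => hp i]; push_cast; rfl⟩

lemma two_pow_mul_sum_bits_s8 (m : ℕ) {n : ℕ} (x : Fin n → ℝ) :
    (2 : ℝ) ^ m * ∑ i : Fin n, (2 : ℝ) ^ (-(i : ℤ) - 1) * x i =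
      (∑ i : Fin n, if (i : ℕ) < m then (2 : ℝ) ^ ((m : ℤ) - (i : ℤ) - 1) * x i else 0) +
      ∑ i : Fin n, if m ≤ (i : ℕ) then (2 : ℝ) ^ ((m : ℤ) - (i : ℤ) - 1) * x i else 0 := by
  rw [Finset.mul_sum, ← Finset.sum_add_distrib]
  refine Finset.sum_congr rfl fun i _ => ?_
  have e : (2 : ℝ) ^ ((m : ℤ) - (i : ℤ) - 1) = 2 ^ m * 2 ^ (-(i : ℤ) - 1) := by
    rw [← zpow_natCast, ← zpow_add₀ two_ne_zero]
    congr 1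
    ring
  by_cases h : (i : ℕ) < m
  · rw [if_pos h, if_neg (by omega), e]
    ring
  · rw [if_neg h, if_pos (by omega), e]
    ring

lemma floor_two_pow_mul_sum_bits {m n : ℕ} (hmn : m ≤ n) {x : Fin n → ℝ}
    (hx : ∀ i, x i = 0 ∨ x i = 1) :
    (⌊(2 : ℝ) ^ m * ∑ i : Fin n, (2 : ℝ) ^ (-(i : ℤ) - 1) * x i⌋ : ℝ) =
      ∑ i : Fin n, if (i : ℕ) < m then (2 : ℝ) ^ ((m : ℤ) - (i : ℤ) - 1) * x i else 0 := by
  obtain ⟨p, hp⟩ := exists_int_eq_sum_head_bits m hx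
  rw [two_pow_mul_sum_bits_s8, hp, Int.floor_intCast_add,
    Int.floor_eq_zero_iff.2 (sum_tail_bits_mem_Ico hmn hx), add_zero]

lemma fract_two_pow_mul_sum_bits {m n : ℕ} (hmn : m ≤ n) {x : Fin n → ℝ}
    (hx : ∀ i, x i = 0 ∨ x i = 1) :
    Int.fract ((2 : ℝ) ^ m * ∑ i : Fin n, (2 : ℝ) ^ (-(i : ℤ) - 1) * x i) =
      ∑ i : Fin n, if m ≤ (i : ℕ) then (2 : ℝ) ^ ((m : ℤ) - (i : ℤ) - 1) * x i else 0 := by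
  rw [Int.fract, floor_two_pow_mul_sum_bits hmn hx, two_pow_mul_sum_bits_s8, add_sub_cancel_left]

lemma isDyadicPoint_sum_bits {n : ℕ} {x : Fin n → ℝ} (hx : ∀ i, x i = 0 ∨ x i = 1) :
    IsDyadicPoint n (∑ i : Fin n, (2 : ℝ) ^ (-(i : ℤ) - 1) * x i) := by
  have h := sum_tail_bits_mem_Ico (Nat.zero_le n) hx
  simp only [Nat.zero_le, if_true, Nat.cast_zero, zero_sub] at h
  refine ⟨h.1, h.2, ?_⟩
  obtain ⟨p, hp⟩ := exists_int_eq_sum_head_bits n hx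
  refine ⟨p, ?_⟩
  rw [two_pow_mul_sum_bits_s8, hp, Finset.sum_eq_zero fun i _ => if_neg (by omega), add_zero]

theorem bit_extraction_depth_L (m n L : ℕ) (hm : 1 ≤ m) (hmn : m ≤ n) (hL : 1 ≤ L) :
    ∃ f ∈ NN 1 2 (2 ^ ((m + L - 1) / L + 2) + 2) L,
      ∀ x : Fin n → ℝ, (∀ i, x i = 0 ∨ x i = 1) →
        f (fun _ => ∑ i : Fin n, (2 : ℝ) ^ (-(i : ℤ) - 1) * x i) 0 =
          (∑ i : Fin n, if (i : ℕ) < m then (2 : ℝ) ^ ((m : ℤ) - (i : ℤ) - 1) * x i else 0) ∧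
        f (fun _ => ∑ i : Fin n, (2 : ℝ) ^ (-(i : ℤ) - 1) * x i) 1 =
          ∑ i : Fin n, if m ≤ (i : ℕ) + 1 then (2 : ℝ) ^ ((m : ℤ) - (i : ℤ) - 2) * x i else 0 := by
  obtain ⟨L, rfl⟩ : ∃ L', L = L' + 1 := ⟨L - 1, by omega⟩
  have hk : 1 ≤ (m + (L + 1) - 1) / (L + 1) := (Nat.one_le_div_iff (by omega)).2 (by omega)
  have hmk : m ≤ (L + 1) * ((m + (L + 1) - 1) / (L + 1)) := by
    have h1 := Nat.div_add_mod (m + (L + 1) - 1) (L + 1)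
    have h2 := Nat.mod_lt (m + (L + 1) - 1) (Nat.succ_pos L)
    rw [Nat.succ_eq_add_one] at h2
    omega
  obtain ⟨f, hf, h⟩ := exists_bit_extraction_network (n := n) hk L (d := 1)
    (u := fun y => y 0) (v := fun _ => 0) hm hmk hmn (.coord 0) (.const 0)
  refine ⟨f, hf, fun x hx => ?_⟩
  obtain ⟨h0, h1⟩ := h (fun _ => ∑ i : Fin n, (2 : ℝ) ^ (-(i : ℤ) - 1) * x i)
    (isDyadicPoint_sum_bits hx) le_rfl
  refine ⟨?_, ?_⟩
  · rw [h0, floor_two_pow_mul_sum_bits hmn hx]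
    simp
  · rw [h1, fract_two_pow_mul_sum_bits (by omega) hx]
    refine Finset.sum_congr rfl fun i _ => ?_
    have e : ((m - 1 : ℕ) : ℤ) - (i : ℤ) - 1 = (m : ℤ) - (i : ℤ) - 2 := by omega
    rw [e]
    simp only [Nat.sub_le_iff_le_add]
end

section
/- (Representation of sparse integer vectors) Let N, M ∈ ℕ with N ≥ M ≥ 1 and let x = (x₁,…,x_N) ∈ ℤ^N satisfy Σ_{n=1}^N |x_n| ≤ M. Then for any S, T ∈ ℕ with S, T ≥ 1, there exists g ∈ NN_{1,1}(W, L) with W = 22·max{⌈√M/(S·√(T+2))⌉, ⌈(N/M)^{1/T}⌉} + 10 and L = 4S(T+2), such that g(n) = x_n for all n = 1,…,N. -/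
open MeasureTheory ENNReal Finset

section Networks

variable {X : Type*}

/-- Integer affine combinations of a set of integer-valued functions. -/
def intAffineSpan (F : Set (X → ℤ)) : Submodule ℤ (X → ℤ) := Submodule.span ℤ (insert 1 F)

theorem subset_intAffineSpan {F : Set (X → ℤ)} {f : X → ℤ} (hf : f ∈ F) :
    f ∈ intAffineSpan F :=
  Submodule.subset_span (Set.mem_insert_of_mem _ hf)

theorem const_mem_intAffineSpan (F : Set (X → ℤ)) (c : ℤ) :
    (fun _ => c) ∈ intAffineSpan F := by
  have h : (1 : X → ℤ) ∈ intAffineSpan F := Submodule.subset_span (Set.mem_insert _ _)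
  have := (intAffineSpan F).smul_mem c h
  convert this using 1
  funext x
  simp

theorem intAffineSpan_le {F G : Set (X → ℤ)} (h : ∀ f ∈ F, f ∈ intAffineSpan G) :
    intAffineSpan F ≤ intAffineSpan G := by
  refine Submodule.span_le.2 (Set.insert_subset ?_ h)
  exact const_mem_intAffineSpan G 1

/-- The functions in `G` are integer affine combinations of at most `k` ReLU neurons, each applied
to an integer affine combination of functions in `F`. -/
def OneLayer (F : Set (X → ℤ)) (k : ℕ) (G : Set (X → ℤ)) : Prop :=
  ∃ s : Finset (X → ℤ), #s ≤ k ∧ (∀ u ∈ s, u ∈ intAffineSpan F) ∧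
    ∀ g ∈ G, g ∈ intAffineSpan ((fun (u : X → ℤ) x => max (u x) 0) '' (s : Set (X → ℤ)))

namespace OneLayer

variable {F G G' : Set (X → ℤ)} {k l : ℕ}

theorem mono (h : OneLayer F k G) (hkl : k ≤ l) (hG : ∀ g ∈ G', g ∈ intAffineSpan G) :
    OneLayer F l G' := by
  obtain ⟨s, hs, hsF, hsG⟩ := h
  exact ⟨s, hs.trans hkl, hsF, fun g hg => intAffineSpan_le hsG (hG g hg)⟩

theorem union (h : OneLayer F k G) (h' : OneLayer F l G') : OneLayer F (k + l) (G ∪ G') := by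
  classical
  obtain ⟨s, hs, hsF, hsG⟩ := h
  obtain ⟨t, ht, htF, htG⟩ := h'
  refine ⟨s ∪ t, (card_union_le s t).trans (add_le_add hs ht), ?_, ?_⟩
  · intro u hu
    exact (mem_union.1 hu).elim (hsF u) (htF u)
  · rintro g (hg | hg)
    · refine intAffineSpan_le (fun f hf => subset_intAffineSpan ?_) (hsG g hg)
      exact Set.image_mono (by simp) hf
    · refine intAffineSpan_le (fun f hf => subset_intAffineSpan ?_) (htG g hg)
      exact Set.image_mono (by simp) hf

theorem iUnion {ι : Type*} [Fintype ι] {G : ι → Set (X → ℤ)} (h : ∀ i, OneLayer F k (G i)) :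
    OneLayer F (Fintype.card ι * k) (⋃ i, G i) := by
  classical
  choose s hs hsF hsG using h
  refine ⟨univ.biUnion s, card_biUnion_le_card_mul _ _ _ fun i _ => hs i, ?_, ?_⟩
  · intro u hu
    obtain ⟨i, -, hi⟩ := mem_biUnion.1 hu
    exact hsF i u hi
  · intro g hg
    obtain ⟨i, hi⟩ := Set.mem_iUnion.1 hg
    refine intAffineSpan_le (fun f hf => subset_intAffineSpan ?_) (hsG i g hi)
    refine Set.image_mono ?_ hf
    exact_mod_cast subset_biUnion_of_mem s (mem_univ i)

theorem sub_of_neurons {u v : X → ℤ} (hu : u ∈ intAffineSpan F) (hv : v ∈ intAffineSpan F) :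
    OneLayer F 2 {fun x => max (u x) 0 - max (v x) 0} := by
  classical
  refine ⟨{u, v}, card_le_two, by simp [hu, hv], ?_⟩
  rintro g rfl
  refine Submodule.sub_mem _ (subset_intAffineSpan ⟨u, by simp, rfl⟩)
    (subset_intAffineSpan ⟨v, by simp, rfl⟩)

theorem pass {u : X → ℤ} (hu : u ∈ intAffineSpan F) : OneLayer F 2 {u} := by
  convert sub_of_neurons hu (Submodule.neg_mem _ hu) using 2
  funext x
  simp only [Pi.neg_apply]
  omega

/-- A pair of neurons multiplies a bounded integer-valued function by an indicator function. -/
theorem ite_nonneg [Finite X] {c d : X → ℤ} (hc : c ∈ intAffineSpan F)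
    (hd : d ∈ intAffineSpan F) : OneLayer F 2 {fun x => if 0 ≤ d x then c x else 0} := by
  obtain ⟨K, hK⟩ : ∃ K : ℤ, ∀ x, |c x| ≤ K := by
    obtain ⟨K, hK⟩ := (Set.finite_range fun x => |c x|).bddAbove
    exact ⟨K, fun x => hK ⟨x, rfl⟩⟩
  have hv : (fun _ => K) + (2 * K) • d ∈ intAffineSpan F :=
    Submodule.add_mem _ (const_mem_intAffineSpan F K) (Submodule.smul_mem _ _ hd)
  convert sub_of_neurons (Submodule.add_mem _ hc hv) hv using 2
  funext x
  have hx := abs_le.1 (hK x)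
  simp only [Pi.add_apply, Pi.smul_apply, smul_eq_mul]
  split_ifs with h
  · have : 0 ≤ K * d x := mul_nonneg (by omega) h
    rw [mul_assoc, max_eq_left, max_eq_left] <;> linarith
  · have : K * d x ≤ K * (-1) := mul_le_mul_of_nonneg_left (by omega) (by omega)
    rw [mul_assoc, max_eq_right, max_eq_right] <;> linarith

end OneLayer

/-- The functions in `G` are simultaneously computed from the single input `f` by `L` hidden ReLU
layers of width at most `W` with integer weights. -/
def Reach (W : ℕ) (f : X → ℤ) : ℕ → Set (X → ℤ) → Prop
  | 0, G => ∀ g ∈ G, g ∈ intAffineSpan {f}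
  | L + 1, G => ∃ F, Reach W f L F ∧ OneLayer F W G

theorem Reach.step {W : ℕ} {f : X → ℤ} {L k : ℕ} {F G G' : Set (X → ℤ)} (h : Reach W f L F)
    (hG : OneLayer F k G) (hk : k ≤ W) (hG' : ∀ g ∈ G', g ∈ intAffineSpan G) :
    Reach W f (L + 1) G' :=
  ⟨F, h, hG.mono hk hG'⟩

theorem Reach.mono_depth {W : ℕ} (hW : 2 ≤ W) {f : X → ℤ} {L L' : ℕ} {g : X → ℤ}
    (h : Reach W f L {g}) (hL : L ≤ L') : Reach W f L' {g} := by
  induction L', hL using Nat.le_induction with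
  | base => exact h
  | succ L' _ ih =>
    exact ih.step (OneLayer.pass (subset_intAffineSpan (Set.mem_singleton g))) hW
      fun _ hg => subset_intAffineSpan hg

theorem exists_coeff_of_mem_intAffineSpan {k : ℕ} {v : Fin k → X → ℤ} {g : X → ℤ}
    (hg : g ∈ intAffineSpan (Set.range v)) :
    ∃ (m : Fin k → ℤ) (c : ℤ), ∀ x, g x = ∑ j, m j * v j x + c := by
  obtain ⟨c, z, hz, rfl⟩ := Submodule.mem_span_insert.1 hg
  obtain ⟨m, rfl⟩ := (Submodule.mem_span_range_iff_exists_fun ℤ).1 hz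
  exact ⟨m, c, fun x => by simp [add_comm]⟩

theorem NNaux_append {d k k' W L : ℕ} {h : (Fin d → ℝ) → (Fin k → ℝ)} (hk : 1 ≤ k) (hkW : k ≤ W)
    (hh : h ∈ NNaux k W L d) {A : (Fin k → ℝ) → (Fin k' → ℝ)} (hA : IsAffineMap A) :
    (fun x => A (fun i => relu (h x i))) ∈ NNaux k' W (L + 1) d := by
  induction L generalizing d with
  | zero => exact ⟨k, hk, hkW, h, A, hh, hA, rfl⟩
  | succ L ih =>
    obtain ⟨N, hN, hNW, B, h', hB, hh', rfl⟩ := hh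
    exact ⟨N, hN, hNW, B, _, hB, ih hh', rfl⟩

theorem Reach.exists_mem_NNaux {W : ℕ} (hW : 1 ≤ W) {f : X → ℤ} {L : ℕ} {G : Set (X → ℤ)}
    (h : Reach W f L G) {k : ℕ} (g : Fin k → X → ℤ) (hg : ∀ i, g i ∈ intAffineSpan G) :
    ∃ φ ∈ NNaux k W L 1, ∀ x i, φ (fun _ => (f x : ℝ)) i = g i x := by
  classical
  induction L generalizing k G with
  | zero =>
    have key : ∀ i, ∃ (m : Fin 1 → ℤ) (c : ℤ), ∀ x, g i x = ∑ j, m j * f x + c := fun i =>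
      exists_coeff_of_mem_intAffineSpan (v := fun _ => f)
        (by simpa using intAffineSpan_le h (hg i))
    choose m c hmc using key
    refine ⟨fun x i => (∑ j, (m i j : ℝ) * x j) + c i, ⟨fun i j => m i j, fun i => c i, ?_⟩, ?_⟩
    · intro x i
      rfl
    · intro x i
      rw [hmc]
      push_cast
      rfl
  | succ L ih =>
    obtain ⟨F, hF, s, hs, hsF, hsG⟩ := h
    obtain ⟨t, ht1, htW, htF, hst⟩ : ∃ t : Finset (X → ℤ), 1 ≤ #t ∧ #t ≤ W ∧
        (∀ u ∈ t, u ∈ intAffineSpan F) ∧ s ⊆ t := by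
      rcases s.eq_empty_or_nonempty with rfl | hne
      · exact ⟨{0}, by simp, by simpa using hW, by simp, by simp⟩
      · exact ⟨s, hne.card_pos, hs, hsF, subset_rfl⟩
    let e : Fin #t ≃ t := t.equivFin.symm
    obtain ⟨φ, hφ, hφe⟩ := ih hF (fun i => (e i : X → ℤ)) fun i => htF _ (e i).2
    have key : ∀ i, ∃ (m : Fin #t → ℤ) (c : ℤ), ∀ x,
        g i x = ∑ j, m j * max ((e j : X → ℤ) x) 0 + c := fun i => by
      refine exists_coeff_of_mem_intAffineSpan (v := fun j x => max ((e j : X → ℤ) x) 0) ?_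
      refine intAffineSpan_le (fun a ha => ?_) (hg i)
      refine intAffineSpan_le (fun b hb => subset_intAffineSpan ?_) (hsG a ha)
      obtain ⟨u, hu, rfl⟩ := hb
      exact ⟨e.symm ⟨u, hst hu⟩, by simp⟩
    choose m c hmc using key
    refine ⟨_, NNaux_append (A := fun y i => (∑ j, (m i j : ℝ) * y j) + c i) ht1 htW hφ
      ⟨fun i j => m i j, fun i => c i, fun x i => rfl⟩, ?_⟩
    intro x i
    simp only [hφe, hmc, relu]
    push_cast
    rfl

end Networks

section Lookup

variable {X : Type*}

theorem Reach.of_mem {W : ℕ} {f : X → ℤ} {L : ℕ} {F G : Set (X → ℤ)} (h : Reach W f L F)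
    (hG : ∀ g ∈ G, g ∈ intAffineSpan F) : Reach W f L G := by
  cases L with
  | zero => exact fun g hg => intAffineSpan_le h (hG g hg)
  | succ L =>
    obtain ⟨F', hF', h'⟩ := h
    exact ⟨F', hF', h'.mono le_rfl hG⟩

/-- Telescoping of the increments of `h` on the interval `[k, k + q]`, cut off at `R`. -/
theorem apply_min_add (h : ℕ → ℤ) (R k q : ℕ) :
    h (min R (k + q)) = h (min R k) +
      ∑ a ∈ range q, if k + a + 1 ≤ R then h (k + a + 1) - h (k + a) else 0 := by
  induction q with
  | zero => simp
  | succ q ih =>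
    rw [sum_range_succ, ← add_assoc (h (min R k)), ← ih]
    split_ifs with hR
    · rw [min_eq_right (by omega : k + (q + 1) ≤ R), min_eq_right (by omega : k + q ≤ R)]
      simp [add_assoc]
    · rw [min_eq_left (by omega : R ≤ k + (q + 1)), min_eq_left (by omega : R ≤ k + q)]
      simp

/-- Finitely many functions of an index `R`, which is given by thresholds on `p`, are tabulated at
a rate of `q` indices per layer. -/
theorem Reach.table {ι : Type*} [Fintype ι] [Finite X] {W : ℕ} {f : X → ℤ} {L q : ℕ} {p : X → ℤ}
    {R : X → ℕ} {θ : ℕ → ℤ} (hθ : ∀ x k, k ≤ R x ↔ θ k ≤ p x)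
    (hW : q * 2 + 2 + Fintype.card ι * 2 ≤ W) (h : ι → ℕ → ℤ) (hp : Reach W f L {p}) (l : ℕ) :
    Reach W f (L + l) ({p} ∪ Set.range fun i x => h i (min (R x) (l * q))) := by
  induction l with
  | zero =>
    refine hp.of_mem ?_
    rintro g (rfl | ⟨i, rfl⟩)
    · exact subset_intAffineSpan rfl
    · simpa using const_mem_intAffineSpan {p} (h i 0)
  | succ l ih =>
    set F := {p} ∪ Set.range fun i x => h i (min (R x) (l * q))
    have hpF : p ∈ intAffineSpan F := subset_intAffineSpan (Or.inl rfl)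
    have h1 : OneLayer F (q * 2)
        (⋃ a : Fin q, {fun x => if 0 ≤ p x - θ (l * q + a + 1) then 1 else 0}) := by
      simpa using OneLayer.iUnion fun a : Fin q => OneLayer.ite_nonneg
        (const_mem_intAffineSpan F 1)
        (Submodule.sub_mem _ hpF (const_mem_intAffineSpan F (θ (l * q + a + 1))))
    have h2 := OneLayer.pass hpF
    have h3 := OneLayer.iUnion fun i : ι => OneLayer.pass (F := F)
      (u := fun x => h i (min (R x) (l * q))) (subset_intAffineSpan (Or.inr ⟨i, rfl⟩))
    refine ih.step ((h1.union h2).union h3) hW ?_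
    rintro g (rfl | ⟨i, rfl⟩)
    · exact subset_intAffineSpan (Or.inl (Or.inr rfl))
    · have hsum : (fun x => h i (min (R x) ((l + 1) * q))) =
          (fun x => h i (min (R x) (l * q))) + ∑ a : Fin q,
            (h i (l * q + a + 1) - h i (l * q + a)) •
              fun x => if 0 ≤ p x - θ (l * q + a + 1) then 1 else 0 := by
        funext x
        simp only [add_mul, one_mul, apply_min_add, hθ, Pi.add_apply, Finset.sum_apply,
          Pi.smul_apply, smul_eq_mul, sub_nonneg, mul_ite, mul_one, mul_zero]
        rw [sum_range]
      simp only [hsum]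
      exact Submodule.add_mem _
        (subset_intAffineSpan (Or.inr (Set.mem_iUnion.2 ⟨i, rfl⟩)))
        (Submodule.sum_mem _ fun a _ => Submodule.smul_mem _ _
          (subset_intAffineSpan (Or.inl (Or.inl (Set.mem_iUnion.2 ⟨a, rfl⟩)))))

/-- Finitely many functions of an index `j < l * q * m`, which is given by thresholds on `p`, are
computed in `l + 1` layers of width proportional to `q + m`. -/
theorem Reach.lookup {κ : Type*} [Fintype κ] [Finite X] {W : ℕ} {f : X → ℤ} {L q m l : ℕ}
    {p : X → ℤ} {j : X → ℕ} {θ : ℕ → ℤ} (hθ : ∀ x k, k ≤ j x ↔ θ k ≤ p x)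
    (hm : 0 < m) (hj : ∀ x, j x < l * q * m)
    (hW : q * 2 + 2 + (m + m * Fintype.card κ + Fintype.card κ) * 2 ≤ W)
    (v : κ → ℕ → ℤ) (hp : Reach W f L {p}) :
    Reach W f (L + l + 1) ({p} ∪ Set.range fun k x => v k (j x)) := by
  let h : Fin m ⊕ (Fin m × κ) ⊕ κ → ℕ → ℤ := Sum.elim (fun b R => θ (R * m + b + 1))
    (Sum.elim (fun bk R => v bk.2 (R * m + bk.1 + 1) - v bk.2 (R * m + bk.1))
      (fun k R => v k (R * m)))
  have hR : ∀ x k, k ≤ j x / m ↔ θ (k * m) ≤ p x := fun x k => by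
    rw [← hθ, Nat.le_div_iff_mul_le hm]
  have htab := Reach.table (q := q) (R := fun x => j x / m) (θ := fun k => θ (k * m)) hR
    (by simpa [add_assoc] using hW) h hp l
  have hmin : ∀ x, min (j x / m) (l * q) = j x / m := fun x =>
    min_eq_left (Nat.div_lt_of_lt_mul (by rw [mul_comm]; exact hj x)).le
  simp only [hmin] at htab
  set F := {p} ∪ Set.range fun i x => h i (j x / m)
  have hpF : p ∈ intAffineSpan F := subset_intAffineSpan (Or.inl rfl)
  have h1 : OneLayer F _ _ := OneLayer.iUnion fun bk : Fin m × κ => OneLayer.ite_nonneg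
    (c := fun x => h (.inr (.inl bk)) (j x / m)) (d := p - fun x => h (.inl bk.1) (j x / m))
    (subset_intAffineSpan (Or.inr ⟨_, rfl⟩))
    (Submodule.sub_mem _ hpF (subset_intAffineSpan (Or.inr ⟨_, rfl⟩)))
  have h2 := OneLayer.pass hpF
  have h3 := OneLayer.iUnion fun k : κ => OneLayer.pass (F := F)
    (u := fun x => h (.inr (.inr k)) (j x / m)) (subset_intAffineSpan (Or.inr ⟨_, rfl⟩))
  refine htab.step ((h1.union h2).union h3) ?_ ?_
  · simp only [Fintype.card_prod, Fintype.card_fin]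
    linarith
  · rintro g (rfl | ⟨k, rfl⟩)
    · exact subset_intAffineSpan (Or.inl (Or.inr rfl))
    · suffices hsum : (fun x => v k (j x)) =
          (fun x => h (.inr (.inr k)) (j x / m)) + ∑ b : Fin m, fun x =>
            if 0 ≤ (p - fun x => h (.inl b) (j x / m)) x then h (.inr (.inl (b, k))) (j x / m)
              else 0 by
        simp only [hsum]
        exact Submodule.add_mem _
          (subset_intAffineSpan (Or.inr (Set.mem_iUnion.2 ⟨k, rfl⟩)))
          (Submodule.sum_mem _ fun b _ =>
            subset_intAffineSpan (Or.inl (Or.inl (Set.mem_iUnion.2 ⟨(b, k), rfl⟩))))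
      funext x
      have hlow : j x / m * m ≤ j x := Nat.div_mul_le_self _ _
      have hup : j x ≤ j x / m * m + m := (Nat.lt_div_mul_add hm).le
      have htel := apply_min_add (v k) (j x) (j x / m * m) m
      rw [min_eq_left hup, min_eq_right hlow] at htel
      simp only [htel, hθ, Pi.add_apply, Finset.sum_apply, Pi.sub_apply, sub_nonneg, h, Sum.elim_inl,
        Sum.elim_inr]
      rw [sum_range]

end Lookup

section Decoding

variable {X : Type*}

/-- The leading digit of a base-`B` code and the remaining code are computed by a single layer. -/
theorem OneLayer.digit [Finite X] {F : Set (X → ℤ)} {c d c' : X → ℤ} {P : ℤ} {B : ℕ}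
    (hc : c ∈ intAffineSpan F) (hdc : ∀ x, c x = d x * P + c' x)
    (hc' : ∀ x, 0 ≤ c' x ∧ c' x < P) (hd : ∀ x, 0 ≤ d x ∧ d x < B) :
    OneLayer F (B * 2 + 2) {d, c'} := by
  have h1 : OneLayer F (B * 2)
      (⋃ e : Fin B, {fun x => if 0 ≤ c x - (e + 1) * P then 1 else 0}) := by
    simpa using OneLayer.iUnion fun e : Fin B => OneLayer.ite_nonneg
      (const_mem_intAffineSpan F 1)
      (Submodule.sub_mem _ hc (const_mem_intAffineSpan F ((e + 1) * P)))
  have h2 := h1.union (OneLayer.pass hc)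
  have hmem : d ∈ intAffineSpan
      ((⋃ e : Fin B, {fun x => if 0 ≤ c x - (e + 1) * P then 1 else 0}) ∪ {c}) := by
    have hsum := Submodule.sum_mem _ fun (e : Fin B) (_ : e ∈ univ) =>
      subset_intAffineSpan (F := (⋃ e : Fin B,
        {fun x => if 0 ≤ c x - (e + 1) * P then 1 else 0}) ∪ {c})
        (Or.inl (Set.mem_iUnion.2 ⟨e, rfl⟩))
    convert hsum using 1
    funext x
    obtain ⟨n, hn⟩ := Int.eq_ofNat_of_zero_le (hd x).1
    have hnB : n < B := by have := (hd x).2; omega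
    have hiff : ∀ e : ℕ, 0 ≤ c x - (e + 1) * P ↔ e < n := fun e => by
      rw [hdc, hn]
      have hP : 0 < P := (hc' x).1.trans_lt (hc' x).2
      constructor
      · intro h
        by_contra hne
        have : (n : ℤ) * P ≤ e * P := mul_le_mul_of_nonneg_right (by omega) hP.le
        linarith [(hc' x).2]
      · intro h
        have : ((e : ℤ) + 1) * P ≤ n * P := mul_le_mul_of_nonneg_right (by omega) hP.le
        linarith [(hc' x).1]
    simp only [Finset.sum_apply, hiff]
    rw [← sum_range fun e => if e < n then (1 : ℤ) else 0, sum_boole, hn]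
    congr 1
    have : {e ∈ range B | e < n} = range n := by
      ext e
      simp only [mem_filter, mem_range]
      omega
    rw [this, card_range]
  refine h2.mono le_rfl ?_
  rintro g (rfl | rfl)
  · exact hmem
  · have := Submodule.sub_mem _ (subset_intAffineSpan (Or.inr rfl) : c ∈ _)
      (Submodule.smul_mem _ P hmem)
    convert this using 1
    funext x
    simp only [Pi.sub_apply, Pi.smul_apply, smul_eq_mul, hdc x]
    ring

variable {W B : ℕ} {f : X → ℤ} {L : ℕ}

theorem Reach.subtract_digits [Finite X] (hW : B * 2 + 6 ≤ W) {P : ℤ} {c' o : X → ℤ}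
    (hc' : ∀ x, 0 ≤ c' x ∧ c' x < P) {t : ℕ} {a c r : X → ℤ} (hac : ∀ x, c x = a x * P + c' x)
    (ha : ∀ x, 0 ≤ a x ∧ a x < (B : ℤ) ^ t) (h : Reach W f L {r, o, c}) :
    Reach W f (L + t) {r - a, o, c'} := by
  induction t generalizing L a c r with
  | zero =>
    have ha0 : a = 0 := by
      funext x
      have := ha x
      rw [pow_zero] at this
      simp only [Pi.zero_apply]
      omega
    have hc : c = c' := by
      funext x
      rw [hac, ha0]
      simp
    simpa [ha0, ← hc] using h
  | succ t ih =>
    have hpos : ∀ x : X, 0 < (B : ℤ) ^ t := fun x => by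
      have hx := ha x
      rcases Nat.eq_zero_or_pos B with rfl | hB
      · simp at hx
        omega
      · positivity
    set d : X → ℤ := fun x => a x / (B : ℤ) ^ t
    set a' : X → ℤ := fun x => a x % (B : ℤ) ^ t
    have hda : ∀ x, a x = d x * (B : ℤ) ^ t + a' x := fun x => by
      simp only [d, a']
      linarith [Int.mul_ediv_add_emod (a x) ((B : ℤ) ^ t)]
    have ha' : ∀ x, 0 ≤ a' x ∧ a' x < (B : ℤ) ^ t := fun x =>
      ⟨Int.emod_nonneg _ (hpos x).ne', Int.emod_lt_of_pos _ (hpos x)⟩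
    have hd : ∀ x, 0 ≤ d x ∧ d x < B := fun x =>
      ⟨Int.ediv_nonneg (ha x).1 (hpos x).le, Int.ediv_lt_of_lt_mul (hpos x)
        (by have := (ha x).2; rwa [pow_succ'] at this)⟩
    set F : Set (X → ℤ) := {r, o, c}
    have hdig : OneLayer F (B * 2 + 2) {d, fun x => a' x * P + c' x} := by
      refine OneLayer.digit (c := c) (P := (B : ℤ) ^ t * P) (subset_intAffineSpan (by simp [F]))
        (fun x => ?_) (fun x => ?_) hd
      · rw [hac, hda]
        ring
      · have hP : 0 < P := (hc' x).1.trans_lt (hc' x).2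
        have h1 : (a' x + 1) * P ≤ (B : ℤ) ^ t * P :=
          mul_le_mul_of_nonneg_right (by have := (ha' x).2; omega) hP.le
        have h2 : 0 ≤ a' x * P := mul_nonneg (ha' x).1 hP.le
        constructor <;> linarith [hc' x]
    have hall := (hdig.union (OneLayer.pass (subset_intAffineSpan (by simp [F]) :
      r ∈ intAffineSpan F))).union (OneLayer.pass (subset_intAffineSpan (by simp [F]) :
      o ∈ intAffineSpan F))
    have hnext : Reach W f (L + 1)
        {r - (B : ℤ) ^ t • d, o, fun x => a' x * P + c' x} := by
      refine h.step hall (by omega) ?_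
      rintro g (rfl | rfl | rfl)
      · exact Submodule.sub_mem _ (subset_intAffineSpan (by simp))
          (Submodule.smul_mem _ _ (subset_intAffineSpan (by simp)))
      · exact subset_intAffineSpan (by simp)
      · exact subset_intAffineSpan (by simp)
    have := ih (fun x => rfl) ha' hnext
    have hr : r - (B : ℤ) ^ t • d - a' = r - a := by
      funext x
      simp only [Pi.sub_apply, Pi.smul_apply, smul_eq_mul, hda x]
      ring
    rwa [hr, add_assoc, add_comm 1 t] at this

/-- One symbol of a code, consisting of a leading digit `e` and an increment `δ`, is processed:
`e - 1` is added to the output if the cursor difference vanishes, and then the cursor advances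
by `δ`. -/
theorem Reach.symbol [Finite X] (hW : B * 2 + 6 ≤ W) (hW' : 10 ≤ W) {T : ℕ} {P : ℤ}
    {r o c e δ c' : X → ℤ} (hc' : ∀ x, 0 ≤ c' x ∧ c' x < P)
    (hc : ∀ x, c x = (e x * (B : ℤ) ^ T + δ x) * P + c' x) (he : ∀ x, 0 ≤ e x ∧ e x < B)
    (hδ : ∀ x, 0 ≤ δ x ∧ δ x < (B : ℤ) ^ T) (h : Reach W f L {r, o, c}) :
    Reach W f (L + (T + 2))
      {r - δ, fun x => o x + if r x = 0 then e x - 1 else 0, c'} := by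
  set c₁ : X → ℤ := fun x => δ x * P + c' x
  have hstate : Reach W f (L + 1) {r, o, c₁, e} := by
    set F : Set (X → ℤ) := {r, o, c}
    have hdig : OneLayer F (B * 2 + 2) {e, c₁} := by
      refine OneLayer.digit (c := c) (P := (B : ℤ) ^ T * P) (subset_intAffineSpan (by simp [F]))
        (fun x => ?_) (fun x => ?_) he
      · rw [hc]
        ring
      · have hP : 0 < P := (hc' x).1.trans_lt (hc' x).2
        have h1 : (δ x + 1) * P ≤ (B : ℤ) ^ T * P :=
          mul_le_mul_of_nonneg_right (by have := (hδ x).2; omega) hP.le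
        have h2 : 0 ≤ δ x * P := mul_nonneg (hδ x).1 hP.le
        simp only [c₁]
        constructor <;> linarith [hc' x]
    have hall := (hdig.union (OneLayer.pass (subset_intAffineSpan (by simp [F]) :
      r ∈ intAffineSpan F))).union (OneLayer.pass (subset_intAffineSpan (by simp [F]) :
      o ∈ intAffineSpan F))
    refine h.step hall (by omega) fun g hg => subset_intAffineSpan ?_
    rcases hg with rfl | rfl | rfl | rfl <;> simp
  have hout : Reach W f (L + 1 + 1)
      {r, fun x => o x + if r x = 0 then e x - 1 else 0, c₁} := by
    set F : Set (X → ℤ) := {r, o, c₁, e}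
    have hr : r ∈ intAffineSpan F := subset_intAffineSpan (by simp [F])
    have he1 : e - (fun _ => 1) ∈ intAffineSpan F :=
      Submodule.sub_mem _ (subset_intAffineSpan (by simp [F])) (const_mem_intAffineSpan F 1)
    have h1 := OneLayer.ite_nonneg he1 hr
    have h2 := OneLayer.ite_nonneg he1 (Submodule.sub_mem _ hr (const_mem_intAffineSpan F 1))
    have hall := (((h1.union h2).union (OneLayer.pass hr)).union
      (OneLayer.pass (subset_intAffineSpan (by simp [F]) : o ∈ intAffineSpan F))).union
      (OneLayer.pass (subset_intAffineSpan (by simp [F]) : c₁ ∈ intAffineSpan F))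
    refine hstate.step hall (by omega) ?_
    rintro g (rfl | rfl | rfl)
    · exact subset_intAffineSpan (by simp)
    · have hsum : (fun x => o x + if r x = 0 then e x - 1 else 0) =
          o + ((fun x => if 0 ≤ r x then (e - fun _ => 1 : X → ℤ) x else 0) -
            fun x => if 0 ≤ (r - fun _ => 1 : X → ℤ) x then (e - fun _ => 1 : X → ℤ) x else 0) := by
        funext x
        simp only [Pi.add_apply, Pi.sub_apply]
        split_ifs <;> omega
      simp only [hsum]
      exact Submodule.add_mem _
        (subset_intAffineSpan (Or.inl (Or.inr rfl))) (Submodule.sub_mem _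
        (subset_intAffineSpan (Or.inl (Or.inl (Or.inl (Or.inl rfl)))))
        (subset_intAffineSpan (Or.inl (Or.inl (Or.inl (Or.inr rfl))))))
    · exact subset_intAffineSpan (by simp)
  have := Reach.subtract_digits hW hc' (fun x => rfl) hδ hout
  rwa [show L + 1 + 1 + T = L + (T + 2) by omega] at this

/-- The base-`Q` number with the `m` digits `σ i, …, σ (i + m - 1)`, most significant first. -/
def blockCode (Q : ℤ) (σ : ℕ → ℤ) : ℕ → ℕ → ℤ
  | _, 0 => 0
  | i, m + 1 => σ i * Q ^ m + blockCode Q σ (i + 1) m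

theorem blockCode_bounds {Q : ℤ} {σ : ℕ → ℤ} (hσ : ∀ i, 0 ≤ σ i ∧ σ i < Q) (i m : ℕ) :
    0 ≤ blockCode Q σ i m ∧ blockCode Q σ i m < Q ^ m := by
  induction m generalizing i with
  | zero => simp [blockCode]
  | succ m ih =>
    have hQ : 0 ≤ Q ^ m := pow_nonneg ((hσ 0).1.trans (hσ 0).2.le) m
    have h1 : 0 ≤ σ i * Q ^ m := mul_nonneg (hσ i).1 hQ
    have h2 : (σ i + 1) * Q ^ m ≤ Q * Q ^ m :=
      mul_le_mul_of_nonneg_right (by have := (hσ i).2; omega) hQ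
    simp only [blockCode, pow_succ']
    constructor <;> linarith [ih (i + 1)]

theorem Reach.decode [Finite X] (hW : B * 2 + 6 ≤ W) (hW' : 10 ≤ W) {T : ℕ} {pos sg : ℕ → ℤ}
    (hpos : ∀ i, 0 ≤ pos (i + 1) - pos i ∧ pos (i + 1) - pos i < (B : ℤ) ^ T)
    (hsg : ∀ i, 0 ≤ sg i + 1 ∧ sg i + 1 < B) {p : X → ℤ} {m : ℕ} {i : X → ℕ} {o : X → ℤ}
    (h : Reach W f L {fun x => p x - pos (i x), o, fun x => blockCode ((B : ℤ) ^ (T + 1))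
      (fun k => (sg k + 1) * (B : ℤ) ^ T + (pos (k + 1) - pos k)) (i x) m}) :
    Reach W f (L + m * (T + 2))
      {fun x => o x + ∑ k ∈ range m, if pos (i x + k) = p x then sg (i x + k) else 0} := by
  induction m generalizing L i o with
  | zero =>
    rw [zero_mul, add_zero]
    refine h.of_mem ?_
    rintro g rfl
    exact subset_intAffineSpan (by simp)
  | succ m ih =>
    set σ : ℕ → ℤ := fun k => (sg k + 1) * (B : ℤ) ^ T + (pos (k + 1) - pos k)
    have hσ : ∀ k, 0 ≤ σ k ∧ σ k < (B : ℤ) ^ (T + 1) := fun k => by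
      have hB : (0 : ℤ) ≤ (B : ℤ) ^ T := by positivity
      have h1 : 0 ≤ (sg k + 1) * (B : ℤ) ^ T := mul_nonneg (hsg k).1 hB
      have h2 : (sg k + 1 + 1) * (B : ℤ) ^ T ≤ B * (B : ℤ) ^ T :=
        mul_le_mul_of_nonneg_right (by have := (hsg k).2; omega) hB
      simp only [σ, pow_succ']
      constructor <;> linarith [hpos k]
    have hstep := Reach.symbol hW hW' (T := T) (e := fun x => sg (i x) + 1)
      (δ := fun x => pos (i x + 1) - pos (i x))
      (fun x => blockCode_bounds hσ (i x + 1) m) (fun x => by simp only [blockCode, σ])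
      (fun x => hsg _) (fun x => hpos _) h
    have hnext := ih (i := fun x => i x + 1)
      (o := fun x => o x + if p x - pos (i x) = 0 then sg (i x) else 0) (by
        convert hstep using 3
        · simp
        · simp)
    rw [show L + (m + 1) * (T + 2) = L + (T + 2) + m * (T + 2) by ring]
    convert hnext using 2
    funext x
    rw [sum_range_succ', add_comm (∑ k ∈ range m, _), ← add_assoc]
    simp only [add_zero, sub_eq_zero, eq_comm (a := p x), add_assoc, add_comm 1]

end Decoding

section Sparse

/-- The first index `n < N` at which a monotone sequence `R` reaches `k`, or `N` if there is
none. -/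
def threshold (R : ℕ → ℕ) (N k : ℕ) : ℕ := #{n ∈ range N | R n < k}

theorem threshold_le_iff {R : ℕ → ℕ} (hR : Monotone R) {N n : ℕ} (hn : n < N) (k : ℕ) :
    threshold R N k ≤ n ↔ k ≤ R n := by
  constructor
  · intro h
    by_contra! hlt
    have hsub : range (n + 1) ⊆ {n ∈ range N | R n < k} := fun m hm => by
      simp only [mem_range, mem_filter] at hm ⊢
      exact ⟨by omega, (hR (by omega)).trans_lt hlt⟩
    have := card_le_card hsub
    rw [card_range] at this
    unfold threshold at h
    omega
  · intro h
    have hsub : {n ∈ range N | R n < k} ⊆ range n := fun m hm => by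
      simp only [mem_range, mem_filter] at hm ⊢
      by_contra! hnm
      exact absurd (hR hnm) (by omega)
    simpa [threshold] using card_le_card hsub

theorem threshold_le (R : ℕ → ℕ) (N k : ℕ) : threshold R N k ≤ N := by
  simpa [threshold] using card_filter_le (range N) fun n => R n < k

theorem threshold_mono (R : ℕ → ℕ) (N : ℕ) : Monotone (threshold R N) := fun k l hkl =>
  card_le_card fun m hm => by
    simp only [mem_range, mem_filter] at hm ⊢
    omega

theorem sum_dvd_indicator_le {N M D : ℕ} (hD : 0 < D) (hN : N ≤ M * D) :
    ∑ n ∈ range N, (if D ∣ n then 1 else 0) ≤ M := by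
  rw [sum_boole, Nat.cast_id, ← card_range M]
  refine card_le_card_of_injOn (fun n => n / D) (fun n hn => ?_) ?_
  · simp only [coe_filter, mem_range, Set.mem_ofPred_eq, coe_range, Set.mem_Iio] at hn ⊢
    exact (Nat.div_lt_iff_lt_mul hD).2 (hn.1.trans_le hN)
  · intro a ha b hb hab
    simp only [coe_filter, mem_range, Set.mem_ofPred_eq] at ha hb
    obtain ⟨a', rfl⟩ := ha.2
    obtain ⟨b', rfl⟩ := hb.2
    simp only [Nat.mul_div_cancel_left _ hD] at hab
    rw [hab]

/-- An integer vector with small `ℓ¹` norm is the sum of a short sequence of signed unit masses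
(some of which may vanish) at nondecreasing positions with bounded gaps. The number of masses at
positions `< n` is `C n`. -/
theorem exists_signed_unit_masses {N M D : ℕ} (hD : 0 < D) (hN : N ≤ M * D) (y : ℕ → ℤ)
    (hy : ∑ n ∈ range N, (y n).natAbs ≤ M) :
    ∃ (C pos : ℕ → ℕ) (sg : ℕ → ℤ), Monotone C ∧ C N ≤ 2 * M ∧ (∀ n, 0 < C (n + 1)) ∧
      (∀ n < N, ∀ i, pos i ≤ n ↔ i < C (n + 1)) ∧ Monotone pos ∧
      (∀ i, pos (i + 1) ≤ pos i + D) ∧ (∀ i, |sg i| ≤ 1) ∧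
      ∀ n < N, ∑ i ∈ range (C (n + 1)), (if pos i = n then sg i else 0) = y n := by
  set wt : ℕ → ℕ := fun n => (y n).natAbs + if D ∣ n then 1 else 0 with hwt
  set C : ℕ → ℕ := fun n => ∑ m ∈ range n, wt m with hC
  have hCsucc : ∀ n, C (n + 1) = C n + wt n := fun n => sum_range_succ _ _
  have hCmono : Monotone C := monotone_nat_of_le_succ fun n => by
    rw [hCsucc]
    omega
  have hC' : Monotone fun n => C (n + 1) := fun a b hab => hCmono (by omega)
  set pos : ℕ → ℕ := fun i => threshold (fun n => C (n + 1)) N (i + 1) with hpos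
  have hpos_le : ∀ n < N, ∀ i, pos i ≤ n ↔ i < C (n + 1) := fun n hn i =>
    threshold_le_iff hC' hn (i + 1)
  refine ⟨C, pos,
    fun i => if i < C (pos i) + (y (pos i)).natAbs then (y (pos i)).sign else 0,
    hCmono, ?_, ?_, hpos_le, ?_, ?_, ?_, ?_⟩
  · simp only [hC, hwt, sum_add_distrib]
    have := sum_dvd_indicator_le hD hN
    omega
  · intro n
    have h1 : C 1 = wt 0 := by simp [hC]
    have h2 : 0 < wt 0 := by simp [hwt]
    have h3 : C 1 ≤ C (n + 1) := hCmono (by omega)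
    omega
  · intro i k hik
    exact threshold_mono _ _ (by omega)
  · intro i
    by_contra! hlt
    have hN' : pos (i + 1) ≤ N := threshold_le _ _ _
    have h1 : i < C (pos i + 1) := (hpos_le _ (by omega) i).1 le_rfl
    have h2 : ¬ i + 1 < C (pos i + D + 1) := fun h =>
      absurd ((hpos_le _ (by omega) (i + 1)).2 h) (by omega)
    set m := D * (pos i / D + 1) with hm
    have hm1 : pos i < m := Nat.lt_mul_div_succ _ hD
    have hm2 : m ≤ pos i + D := by
      have := Nat.mul_div_le (pos i) D
      rw [hm, mul_add]
      omega
    have h3 : 0 < wt m := by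
      simp only [hwt, hm, dvd_mul_right, if_true]
      omega
    have h4 : C (pos i + 1) ≤ C m := hCmono (by omega)
    have h5 : C (m + 1) ≤ C (pos i + D + 1) := hCmono (by omega)
    have h6 := hCsucc m
    omega
  · intro i
    dsimp only
    split_ifs
    · rcases Int.lt_trichotomy (y (pos i)) 0 with h | h | h
      · simp [Int.sign_eq_neg_one_of_neg h]
      · simp [h]
      · simp [Int.sign_eq_one_of_pos h]
    · simp
  · intro n hn
    have hlt : ∀ i < C n, pos i ≠ n := fun i hi => by
      cases n with
      | zero => simp [hC] at hi
      | succ n =>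
        have := (hpos_le n (by omega) i).2 hi
        omega
    have heq : ∀ k < wt n, pos (C n + k) = n := fun k hk => by
      have h1 : pos (C n + k) ≤ n := (hpos_le n hn _).2 (by rw [hCsucc]; omega)
      cases n with
      | zero => omega
      | succ n =>
        have h2 : ¬ pos (C (n + 1) + k) ≤ n := fun h =>
          absurd ((hpos_le n (by omega) _).1 h) (by omega)
        omega
    rw [hCsucc, sum_range_add, sum_eq_zero fun i hi => if_neg (hlt i (mem_range.1 hi)), zero_add]
    have hterm : ∀ k ∈ range (wt n), (if pos (C n + k) = n then
        (if C n + k < C (pos (C n + k)) + (y (pos (C n + k))).natAbs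
          then (y (pos (C n + k))).sign else 0) else 0) =
        if k < (y n).natAbs then (y n).sign else 0 := fun k hk => by
      simp [heq k (mem_range.1 hk)]
    rw [sum_congr rfl hterm, ← sum_filter]
    have hfil : {k ∈ range (wt n) | k < (y n).natAbs} = range (y n).natAbs := by
      ext k
      simp only [mem_filter, mem_range, hwt]
      omega
    rw [hfil, sum_const, card_range, nsmul_eq_mul, mul_comm]
    exact Int.sign_mul_natAbs (y n)

/-- Splitting a sum of signed masses at the beginning `i₀` of a block of length `S` which contains
the last mass at a position `≤ n`. -/
theorem sum_masses_eq_block {pos : ℕ → ℕ} (hpos : Monotone pos) (sg : ℕ → ℤ) {n c i₀ S : ℕ}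
    (hc : ∀ i, pos i ≤ n ↔ i < c) (h₀ : i₀ < c) (hS : c ≤ i₀ + S) :
    ∑ i ∈ range c, (if pos i = n then sg i else 0) =
      (if n ≤ pos i₀ then ∑ i ∈ range i₀, (if pos i = pos i₀ then sg i else 0) else 0) +
        ∑ k ∈ range S, (if pos (i₀ + k) = n then sg (i₀ + k) else 0) := by
  have hext : ∑ i ∈ range c, (if pos i = n then sg i else 0) =
      ∑ i ∈ range (i₀ + S), (if pos i = n then sg i else 0) := by
    refine sum_subset (range_subset_range.2 hS) fun i _ hi => if_neg fun h => hi ?_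
    exact mem_range.2 ((hc i).1 h.le)
  have hle : pos i₀ ≤ n := (hc i₀).2 h₀
  rw [hext, sum_range_add]
  congr 1
  split_ifs with h
  · rw [le_antisymm hle h]
  · refine sum_eq_zero fun i hi => if_neg fun hi' => ?_
    have := hpos (mem_range.1 hi).le
    omega

/-- The network representation of a sparse vector, in terms of the natural number `w` that
controls the width. -/
theorem reach_sparse_vector {N M : ℕ} (x : Fin N → ℤ) (hx : ∑ n, |x n| ≤ (M : ℤ)) {S T w : ℕ}
    (hS : 1 ≤ S) (hT : 1 ≤ T) (hw : 1 ≤ w) (hMw : M ≤ w ^ 2 * S ^ 2 * (T + 2))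
    (hNw : N ≤ M * w ^ T) :
    Reach (22 * w + 10) (fun n : Fin N => (n : ℤ) + 1) (4 * S * (T + 2)) {x} := by
  set y : ℕ → ℤ := fun n => if h : n < N then x ⟨n, h⟩ else 0 with hy
  have hyx : ∀ n : Fin N, y n = x n := fun n => by simp [hy]
  have hysum : ∑ n ∈ range N, (y n).natAbs ≤ M := by
    rw [sum_range]
    zify
    simpa only [hyx] using hx
  obtain ⟨C, pos, sg, hCmono, hCN, hCpos, hpos_le, hpos, hgap, hsg, hsum⟩ :=
    exists_signed_unit_masses (pow_pos hw T) hNw y hysum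
  set j : ℕ → ℕ := fun n => (C (n + 1) - 1) / S with hj
  have hjmono : Monotone j := fun a b hab =>
    Nat.div_le_div_right (Nat.sub_le_sub_right (hCmono (by omega)) 1)
  have hjlt : ∀ n : Fin N, j n < 2 * S * (T + 2) * w * w := fun n => by
    have h1 : C (n + 1) ≤ C N := hCmono (by omega)
    have h2 := hCpos n
    refine Nat.div_lt_of_lt_mul ?_
    calc C (n + 1) - 1 < 2 * M := by omega
      _ ≤ 2 * (w ^ 2 * S ^ 2 * (T + 2)) := by omega
      _ = S * (2 * S * (T + 2) * w * w) := by ring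
  set p : Fin N → ℤ := fun n => (n : ℤ) with hp
  have hθ : ∀ (n : Fin N) k, k ≤ j n ↔ ((threshold j N k : ℕ) : ℤ) ≤ p n := fun n k => by
    rw [hp, Nat.cast_le, threshold_le_iff hjmono n.2]
  have hp0 : Reach (22 * w + 10) (fun n : Fin N => (n : ℤ) + 1) 0 {p} := by
    rintro g rfl
    have := Submodule.sub_mem _ (subset_intAffineSpan (Set.mem_singleton
      (fun n : Fin N => (n : ℤ) + 1))) (const_mem_intAffineSpan _ 1)
    convert this using 1
    funext n
    simp [hp]
  set σ : ℕ → ℤ := fun k => (sg k + 1) * ((w + 2 : ℕ) : ℤ) ^ T +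
    (((pos (k + 1) : ℕ) : ℤ) - ((pos k : ℕ) : ℤ)) with hσ
  set v : Fin 3 → ℕ → ℤ := ![fun J => (pos (J * S) : ℤ),
    fun J => ∑ i ∈ range (J * S), if pos i = pos (J * S) then sg i else 0,
    fun J => blockCode (((w + 2 : ℕ) : ℤ) ^ (T + 1)) σ (J * S) S] with hv
  have hlook := Reach.lookup (j := fun n : Fin N => j n) hθ hw hjlt
    (by simp only [Fintype.card_fin]; omega) v hp0
  set F : Set (Fin N → ℤ) := {p} ∪ Set.range fun k (n : Fin N) => v k (j n)
  have hpF : p ∈ intAffineSpan F := subset_intAffineSpan (Or.inl rfl)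
  have hvF : ∀ k, (fun n : Fin N => v k (j n)) ∈ intAffineSpan F := fun k =>
    subset_intAffineSpan (Or.inr ⟨k, rfl⟩)
  have hlayer := ((OneLayer.ite_nonneg (hvF 1) (Submodule.sub_mem _ (hvF 0) hpF)).union
    (OneLayer.pass (Submodule.sub_mem _ hpF (hvF 0)))).union (OneLayer.pass (hvF 2))
  have hinit : Reach (22 * w + 10) (fun n : Fin N => (n : ℤ) + 1)
      (0 + 2 * S * (T + 2) + 1 + 1) {fun n : Fin N => p n - pos (j n * S),
        fun n : Fin N => if 0 ≤ (pos (j n * S) : ℤ) - p n then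
          ∑ i ∈ range (j n * S), (if pos i = pos (j n * S) then sg i else 0) else 0,
        fun n : Fin N => blockCode (((w + 2 : ℕ) : ℤ) ^ (T + 1)) σ (j n * S) S} := by
    refine hlook.step hlayer (by omega) fun g hg => subset_intAffineSpan ?_
    rcases hg with rfl | rfl | rfl
    · exact Or.inl (Or.inr rfl)
    · exact Or.inl (Or.inl rfl)
    · exact Or.inr rfl
  have hgap' : ∀ i, 0 ≤ ((pos (i + 1) : ℕ) : ℤ) - ((pos i : ℕ) : ℤ) ∧
      ((pos (i + 1) : ℕ) : ℤ) - ((pos i : ℕ) : ℤ) < ((w + 2 : ℕ) : ℤ) ^ T := fun i => by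
    have h1 := hgap i
    have h2 : pos i ≤ pos (i + 1) := hpos (by omega)
    have h3 : w ^ T < (w + 2) ^ T := Nat.pow_lt_pow_left (by omega) (by omega)
    rw [← Nat.cast_pow]
    omega
  have hsg' : ∀ i, 0 ≤ sg i + 1 ∧ sg i + 1 < ((w + 2 : ℕ) : ℤ) := fun i => by
    have := abs_le.1 (hsg i)
    omega
  have hdec := Reach.decode (W := 22 * w + 10) (B := w + 2) (by omega) (by omega)
    (pos := fun i => (pos i : ℤ)) hgap' hsg' hinit
  have hdepth : 0 + 2 * S * (T + 2) + 1 + 1 + S * (T + 2) ≤ 4 * S * (T + 2) := by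
    nlinarith [Nat.mul_le_mul hS (by omega : 3 ≤ T + 2)]
  convert hdec.mono_depth (by omega) hdepth using 2
  funext n
  have hc := hCpos n
  have hdiv : j n * S ≤ C (n + 1) - 1 := Nat.div_mul_le_self _ _
  have hmod : C (n + 1) - 1 < j n * S + S := Nat.lt_div_mul_add hS
  rw [← hyx, ← hsum n n.2, sum_masses_eq_block (i₀ := j n * S) (S := S) hpos sg
    (hpos_le n n.2) (by omega) (by omega)]
  simp [hp]

end Sparse

theorem rep_sparse_vector (N M : ℕ) (hM : 1 ≤ M) (hNM : M ≤ N)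
    (x : Fin N → ℤ) (hx : ∑ n, |x n| ≤ (M : ℤ))
    (S T : ℕ) (hS : 1 ≤ S) (hT : 1 ≤ T) :
    ∃ g ∈ NN 1 1
        (22 * max ⌈Real.sqrt M / (S * Real.sqrt (T + 2))⌉₊
                  ⌈((N : ℝ) / M) ^ ((T : ℝ)⁻¹)⌉₊ + 10)
        (4 * S * (T + 2)),
      ∀ n : Fin N, g (fun _ => (n : ℝ) + 1) 0 = x n := by
  set w := max ⌈Real.sqrt M / (S * Real.sqrt (T + 2))⌉₊ ⌈((N : ℝ) / M) ^ ((T : ℝ)⁻¹)⌉₊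
  have hMpos : (0 : ℝ) < M := by exact_mod_cast hM
  have hNpos : (0 : ℝ) < N := by exact_mod_cast hM.trans hNM
  have hSpos : (0 : ℝ) < S := by exact_mod_cast hS
  have hroot : ((N : ℝ) / M) ^ ((T : ℝ)⁻¹) ≤ w :=
    (Nat.le_ceil _).trans (Nat.cast_le.2 (le_max_right _ _))
  have hsqrt : Real.sqrt M / (S * Real.sqrt (T + 2)) ≤ w :=
    (Nat.le_ceil _).trans (Nat.cast_le.2 (le_max_left _ _))
  have hw : 1 ≤ w := by
    have : (0 : ℝ) < w := (Real.rpow_pos_of_pos (div_pos hNpos hMpos) _).trans_le hroot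
    exact_mod_cast this
  have hNw : N ≤ M * w ^ T := by
    have h := pow_le_pow_left₀ (by positivity) hroot T
    rw [Real.rpow_inv_natCast_pow (by positivity) (by omega), div_le_iff₀ hMpos, mul_comm] at h
    exact_mod_cast h
  have hMw : M ≤ w ^ 2 * S ^ 2 * (T + 2) := by
    rw [div_le_iff₀ (by positivity)] at hsqrt
    have h := pow_le_pow_left₀ (by positivity) hsqrt 2
    rw [mul_pow, mul_pow, Real.sq_sqrt (by positivity), Real.sq_sqrt (by positivity),
      ← mul_assoc] at h
    exact_mod_cast h
  obtain ⟨g, hg, hgx⟩ := (reach_sparse_vector x hx hS hT hw hMw hNw).exists_mem_NNaux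
    (by omega) (k := 1) (fun _ => x) fun _ => subset_intAffineSpan rfl
  refine ⟨g, hg, fun n => ?_⟩
  have := hgx n 0
  push_cast at this
  exact this
end
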